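/- arXiv:1403.1538 — 2 statements merged into one kernel-verified Lean document; each statement's English description precedes it below -/
import Mathlib

section
/- Let n = 2 and let W ∈ C^{1,1}_{loc}(ℝᵐ;ℝ), m ≥ 1, be nonnegative with W(u) > 0 for all u ≠ a and W(a) = 0 for some a ∈ ℝᵐ. Assume there exists r₀ > 0 such that for every unit vector ν ∈ S^{m-1} the function r ↦ W(a + rν) is nondecreasing for r ∈ (0, r₀]. If u ∈ C²(ℝ²;ℝᵐ) is a bounded, globally minimizing solution of Δu = ∇W(u) on ℝ², then u ≡ a. -/
open MeasureTheory Metric Filter RealInnerProductSpace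

/-- Squared Frobenius norm of the gradient: `|∇u|² = Σᵢ |u_{xᵢ}|²`. -/
noncomputable def gradSq {n m : ℕ}
    (u : EuclideanSpace ℝ (Fin n) → EuclideanSpace ℝ (Fin m))
    (x : EuclideanSpace ℝ (Fin n)) : ℝ :=
  ∑ i : Fin n, ‖fderiv ℝ u x (EuclideanSpace.single i 1)‖ ^ 2

/-- The Laplacian of `u`, computed componentwise: `Δu = Σᵢ u_{xᵢxᵢ}`. -/
noncomputable def vlap {n m : ℕ}
    (u : EuclideanSpace ℝ (Fin n) → EuclideanSpace ℝ (Fin m))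
    (x : EuclideanSpace ℝ (Fin n)) : EuclideanSpace ℝ (Fin m) :=
  ∑ i : Fin n,
    fderiv ℝ (fun y => fderiv ℝ u y (EuclideanSpace.single i 1)) x (EuclideanSpace.single i 1)

/-- The Allen–Cahn energy `E(u;Ω) = ∫_Ω ((1/2)|∇u|² + W(u)) dx`. -/
noncomputable def energy {n m : ℕ} (W : EuclideanSpace ℝ (Fin m) → ℝ)
    (u : EuclideanSpace ℝ (Fin n) → EuclideanSpace ℝ (Fin m))
    (Ω : Set (EuclideanSpace ℝ (Fin n))) : ℝ :=
  ∫ x in Ω, ((1 / 2) * gradSq u x + W (u x))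

/-- `u` is a globally minimizing solution: for every bounded domain `Ω` and every
perturbation `φ ∈ W^{1,2}_0(Ω;ℝᵐ) ∩ L^∞(Ω;ℝᵐ)` (encoded as a Lipschitz, hence
bounded and `W^{1,2}`, function supported in `Ω`), `E(u;Ω) ≤ E(u+φ;Ω)`. -/
def GloballyMinimizing {n m : ℕ} (W : EuclideanSpace ℝ (Fin m) → ℝ)
    (u : EuclideanSpace ℝ (Fin n) → EuclideanSpace ℝ (Fin m)) : Prop :=
  ∀ Ω : Set (EuclideanSpace ℝ (Fin n)), IsOpen Ω → Bornology.IsBounded Ω →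
    ∀ φ : EuclideanSpace ℝ (Fin n) → EuclideanSpace ℝ (Fin m),
      (∃ K : NNReal, LipschitzWith K φ) → tsupport φ ⊆ Ω →
      energy W u Ω ≤ energy W (u + φ) Ω


abbrev EE (n : ℕ) := EuclideanSpace ℝ (Fin n)

lemma gradSq_nonneg' {n m : ℕ} (u : EE n → EE m) (x : EE n) : 0 ≤ gradSq u x :=
  Finset.sum_nonneg fun _ _ => by positivity

lemma gradSq_continuous {n m : ℕ} (u : EE n → EE m) (hu : ContDiff ℝ 2 u) :
    Continuous (gradSq u) := by
  have h : Continuous (fderiv ℝ u) := hu.continuous_fderiv (by norm_num)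
  unfold gradSq
  fun_prop

lemma fderiv_bound {n m : ℕ} (u v : EE n → EE m) (x : EE n) (e : EE n) (he : ‖e‖ = 1)
    (hu : DifferentiableAt ℝ u x) (α β : EE n → ℝ) (hα : ContinuousAt α x)
    (hβ : ContinuousAt β x) (hα0 : 0 ≤ α x) (hβ0 : 0 ≤ β x)
    (h : ∀ᶠ y in nhds x, ‖v y - v x‖ ≤ α y * ‖u y - u x‖ + β y * ‖y - x‖) :
    ‖fderiv ℝ v x e‖ ≤ α x * ‖fderiv ℝ u x e‖ + β x := by
  by_cases hv : DifferentiableAt ℝ v x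
  swap
  · rw [fderiv_zero_of_not_differentiableAt hv]
    simp only [zero_apply, norm_zero]
    positivity
  have h1 := (hv.hasFDerivAt.hasLineDerivAt e).tendsto_slope_zero.norm
  have h2 := (hu.hasFDerivAt.hasLineDerivAt e).tendsto_slope_zero.norm
  have h3 : Tendsto (fun t : ℝ => x + t • e) (nhdsWithin 0 {0}ᶜ) (nhds x) := by
    have : Continuous (fun t : ℝ => x + t • e) := by fun_prop
    have := this.tendsto 0
    simp only [zero_smul, add_zero] at this
    exact this.mono_left nhdsWithin_le_nhds
  have h4 := (((hα.tendsto.comp h3).mul h2).add (hβ.tendsto.comp h3))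
  refine le_of_tendsto_of_tendsto h1 h4 ?_
  filter_upwards [h3.eventually h, self_mem_nhdsWithin] with t ht ht0
  have ht0' : t ≠ 0 := ht0
  have hpos : 0 < ‖t‖ := norm_pos_iff.2 ht0'
  simp only [Function.comp, norm_smul, norm_inv]
  have : ‖x + t • e - x‖ = ‖t‖ := by simp [norm_smul, he]
  rw [this] at ht
  calc ‖t‖⁻¹ * ‖v (x + t • e) - v x‖
      ≤ ‖t‖⁻¹ * (α (x + t • e) * ‖u (x + t • e) - u x‖ + β (x + t • e) * ‖t‖) := by gcongr
    _ = _ := by field_simp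

lemma single_norm {n : ℕ} (i : Fin n) : ‖(EuclideanSpace.single i 1 : EE n)‖ = 1 := by simp

section pot
variable {m : ℕ} (W : EE m → ℝ) (a : EE m)

lemma W_lower (hW : Continuous W) (hWpos : ∀ v, v ≠ a → 0 < W v) (M δ : ℝ) (hδ : 0 < δ) :
    ∃ w > 0, ∀ y, δ ≤ ‖y - a‖ → ‖y - a‖ ≤ M → w ≤ W y := by
  set S : Set (EE m) := {y | δ ≤ ‖y - a‖ ∧ ‖y - a‖ ≤ M} with hS
  have hSc : IsCompact S := by
    refine (isCompact_closedBall a M).of_isClosed_subset ?_ ?_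
    · exact (isClosed_le continuous_const (by fun_prop : Continuous fun y : EE m => ‖y - a‖)).inter
        (isClosed_le (by fun_prop : Continuous fun y : EE m => ‖y - a‖) continuous_const)
    · intro y hy
      simpa [dist_eq_norm] using hy.2
  by_cases hne : S.Nonempty
  · obtain ⟨y0, hy0, hmin⟩ := hSc.exists_isMinOn hne hW.continuousOn
    refine ⟨W y0, hWpos _ ?_, fun y h1 h2 => hmin ⟨h1, h2⟩⟩
    rintro rfl
    have := hy0.1
    simp at this
    linarith
  · exact ⟨1, one_pos, fun y h1 h2 => (hne ⟨y, h1, h2⟩).elim⟩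

lemma W_upper (hW : Continuous W) (M : ℝ) :
    ∃ B, 0 ≤ B ∧ ∀ y, ‖y - a‖ ≤ M → W y ≤ B := by
  obtain ⟨B, hB⟩ := (isCompact_closedBall a M).exists_bound_of_continuousOn hW.continuousOn
  refine ⟨|B|, abs_nonneg _, fun y hy => ?_⟩
  have := hB y (by simpa [dist_eq_norm] using hy)
  exact (le_abs_self _).trans (this.trans (le_abs_self _))

lemma W_interp (hW : Continuous W) (hWa : W a = 0) (hWpos : ∀ v, v ≠ a → 0 < W v)
    (M ε : ℝ) (hε : 0 < ε) :
    ∃ C, 0 ≤ C ∧ ∀ y, ∀ s : ℝ, ‖y - a‖ ≤ M → 0 ≤ s → s ≤ 1 →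
      12 * ‖y - a‖ ^ 2 + W (a + s • (y - a)) ≤ ε + C * W y := by
  have hW0 : ∀ y, 0 ≤ W y := fun y => by
    by_cases h : y = a
    · rw [h, hWa]
    · exact (hWpos y h).le
  have hc : Continuous (fun y => 12 * ‖y - a‖ ^ 2) := by fun_prop
  have h1 : ∀ᶠ y in nhds a, W y < ε / 2 :=
    hW.continuousAt.eventually_lt continuousAt_const (by rw [hWa]; positivity)
  have h2 : ∀ᶠ y in nhds a, 12 * ‖y - a‖ ^ 2 < ε / 2 :=
    hc.continuousAt.eventually_lt continuousAt_const (by simp; positivity)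
  obtain ⟨δ, hδ, hb⟩ := Metric.eventually_nhds_iff_ball.1 (h1.and h2)
  obtain ⟨w, hw, hwl⟩ := W_lower W a hW hWpos M δ hδ
  obtain ⟨B, hB0, hB⟩ := W_upper W a hW M
  refine ⟨(12 * M ^ 2 + B) / w, by positivity, fun y s hy hs0 hs1 => ?_⟩
  have hsn : ‖(a + s • (y - a)) - a‖ ≤ ‖y - a‖ := by
    rw [add_sub_cancel_left, norm_smul, Real.norm_of_nonneg hs0]
    exact mul_le_of_le_one_left (norm_nonneg _) hs1
  by_cases hd : ‖y - a‖ < δ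
  · have e1 := (hb y (by simpa [dist_eq_norm] using hd)).2
    have e2 := (hb (a + s • (y - a)) (by rw [mem_ball, dist_eq_norm]; linarith)).1
    have : 0 ≤ (12 * M ^ 2 + B) / w * W y := mul_nonneg (by positivity) (hW0 y)
    linarith
  · push Not at hd
    have e1 := hwl y hd hy
    have e2 := hB _ (hsn.trans hy)
    have e3 : ‖y - a‖ ^ 2 ≤ M ^ 2 := by gcongr
    have e4 : (12 * M ^ 2 + B) / w * w ≤ (12 * M ^ 2 + B) / w * W y := by gcongr
    rw [div_mul_cancel₀ _ hw.ne'] at e4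
    linarith

end pot

/-- The radial cut-off map. -/
noncomputable def cutR {m : ℕ} (r : ℝ) (x : EE m) : EE m :=
  (min ‖x‖ (max (2 * r - ‖x‖) 0) / ‖x‖) • x

lemma cutR_lip {m : ℕ} (r : ℝ) (x y : EE m) : ‖cutR r x - cutR r y‖ ≤ ‖x - y‖ := by
  set f : ℝ → ℝ := fun t => min t (max (2 * r - t) 0) with hf
  have f0 : ∀ t, 0 ≤ t → 0 ≤ f t := fun t ht => le_min ht (le_max_right _ _)
  have f1 : ∀ t, f t ≤ t := fun t => min_le_left _ _
  have flip : ∀ s t, |f s - f t| ≤ |s - t| := by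
    intro s t
    refine (abs_min_sub_min_le_max _ _ _ _).trans (max_le le_rfl ?_)
    refine (abs_max_sub_max_le_max _ _ _ _).trans (max_le ?_ (by simp))
    rw [abs_sub_comm s t]
    apply le_of_eq
    congr 1
    ring
  have key : ∀ z : EE m, z ≠ 0 → ‖cutR r z‖ = f ‖z‖ := by
    intro z hz
    have : 0 < ‖z‖ := norm_pos_iff.2 hz
    unfold cutR
    rw [norm_smul, Real.norm_of_nonneg (div_nonneg (f0 _ this.le) this.le)]
    exact div_mul_cancel₀ _ this.ne'
  have c0 : cutR r (0 : EE m) = 0 := by simp [cutR]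
  by_cases hx : x = 0
  · subst hx
    by_cases hy : y = 0
    · subst hy; simp
    · rw [c0, zero_sub, zero_sub, norm_neg, norm_neg, key y hy]; exact f1 _
  by_cases hy : y = 0
  · subst hy
    rw [c0, sub_zero, sub_zero, key x hx]; exact f1 _
  have hxn : 0 < ‖x‖ := norm_pos_iff.2 hx
  have hyn : 0 < ‖y‖ := norm_pos_iff.2 hy
  refine (sq_le_sq₀ (norm_nonneg _) (norm_nonneg _)).1 ?_
  rw [norm_sub_sq_real, norm_sub_sq_real, key x hx, key y hy]
  have hin : inner ℝ (cutR r x) (cutR r y) = f ‖x‖ / ‖x‖ * (f ‖y‖ / ‖y‖) * inner ℝ x y := by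
    unfold cutR
    rw [real_inner_smul_left, real_inner_smul_right]
    simp only [hf]; ring
  rw [hin]
  set p := f ‖x‖ / ‖x‖ with hp
  set k := f ‖y‖ / ‖y‖ with hk
  have hp0 : 0 ≤ p := div_nonneg (f0 _ hxn.le) hxn.le
  have hk0 : 0 ≤ k := div_nonneg (f0 _ hyn.le) hyn.le
  have hp1 : p ≤ 1 := (div_le_one hxn).2 (f1 _)
  have hk1 : k ≤ 1 := (div_le_one hyn).2 (f1 _)
  have ex : f ‖x‖ = p * ‖x‖ := (div_mul_cancel₀ _ hxn.ne').symm
  have ey : f ‖y‖ = k * ‖y‖ := (div_mul_cancel₀ _ hyn.ne').symm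
  have hl := flip ‖x‖ ‖y‖
  have hl2 : (f ‖x‖ - f ‖y‖) ^ 2 ≤ (‖x‖ - ‖y‖) ^ 2 := sq_le_sq.2 hl
  rw [ex, ey] at hl2 ⊢
  have hcs := real_inner_le_norm x y
  have hpk : p * k ≤ 1 := mul_le_one₀ hp1 hk0 hk1
  nlinarith [mul_nonneg (sub_nonneg.2 hpk) (sub_nonneg.2 hcs)]

lemma cutR_small {m : ℕ} (r : ℝ) (x : EE m) (hx : ‖x‖ ≤ r) : cutR r x = x := by
  unfold cutR
  by_cases h : x = 0
  · simp [h]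
  · have : 0 < ‖x‖ := norm_pos_iff.2 h
    rw [min_eq_left (le_max_of_le_left (by linarith)), div_self this.ne', one_smul]

lemma cutR_large {m : ℕ} (r : ℝ) (x : EE m) (hx : 2 * r ≤ ‖x‖) : cutR r x = 0 := by
  unfold cutR
  rw [max_eq_right (by linarith), min_eq_right (norm_nonneg _)]
  simp

lemma W_cutR {m : ℕ} (W : EE m → ℝ) (a : EE m) (hWa : W a = 0) (hW0 : ∀ v, 0 ≤ W v)
    (r₀ r : ℝ) (hr : 2 * r ≤ r₀)
    (hmono : ∀ ν : EE m, ‖ν‖ = 1 →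
      MonotoneOn (fun r : ℝ => W (a + r • ν)) (Set.Ioc 0 r₀)) (y : EE m) :
    W (a + cutR r (y - a)) ≤ W y := by
  by_cases h2 : 2 * r ≤ ‖y - a‖
  · rw [cutR_large r _ h2, add_zero, hWa]; exact hW0 y
  push Not at h2
  by_cases h : y - a = 0
  · rw [h]; rw [sub_eq_zero] at h; simp [cutR, h]
  have hp : 0 < ‖y - a‖ := norm_pos_iff.2 h
  set ν := ‖y - a‖⁻¹ • (y - a) with hν
  have hν1 : ‖ν‖ = 1 := by rw [hν, norm_smul, norm_inv, norm_norm, inv_mul_cancel₀ hp.ne']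
  have hy : a + ‖y - a‖ • ν = y := by
    rw [hν, smul_smul, mul_inv_cancel₀ hp.ne', one_smul]; abel
  set t := min ‖y - a‖ (max (2 * r - ‖y - a‖) 0) with ht
  have ht0 : 0 < t := lt_min hp (lt_max_of_lt_left (by linarith))
  have hc : cutR r (y - a) = t • ν := by
    unfold cutR; rw [hν, smul_smul, ← ht, div_eq_mul_inv]
  rw [hc]
  have := hmono ν hν1 (a := t) (b := ‖y - a‖) ⟨ht0, (min_le_left _ _).trans (by linarith)⟩
    ⟨hp, by linarith⟩ (min_le_left _ _)
  simp only [hy] at this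
  exact this

lemma eD_cont {m : ℕ} (W : EE m → ℝ) (hW : Continuous W) (u : EE 2 → EE m)
    (hu : ContDiff ℝ 2 u) : Continuous (fun x => (1 / 2) * gradSq u x + W (u x)) := by
  have h1 := gradSq_continuous u hu
  have h2 := hu.continuous
  fun_prop

lemma intOn_of_cont {f : EE 2 → ℝ} (hf : Continuous f) {s : Set (EE 2)}
    (hs : Bornology.IsBounded s) : IntegrableOn f s := by
  obtain ⟨R, hR⟩ := hs.subset_closedBall 0
  exact (hf.continuousOn.integrableOn_compact (isCompact_closedBall 0 R)).mono_set hR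

lemma lip_ball {m : ℕ} (u : EE 2 → EE m) (hu : ContDiff ℝ 2 u) (R : ℝ) :
    ∃ L, 0 ≤ L ∧ ∀ x ∈ closedBall (0 : EE 2) R, ∀ y ∈ closedBall (0 : EE 2) R,
      ‖u x - u y‖ ≤ L * ‖x - y‖ := by
  have h : Continuous (fderiv ℝ u) := hu.continuous_fderiv (by norm_num)
  obtain ⟨B, hB⟩ := (isCompact_closedBall (0 : EE 2) R).exists_bound_of_continuousOn h.continuousOn
  refine ⟨|B|, abs_nonneg _, fun x hx y hy => ?_⟩
  exact (convex_closedBall (0 : EE 2) R).norm_image_sub_le_of_norm_fderiv_le (𝕜 := ℝ)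
    (fun z _ => (hu.differentiable (by norm_num)) z)
    (fun z hz => (hB z hz).trans (le_abs_self B)) hy hx

/-- The main comparison statement, in integral form. -/
lemma energy_compare {m : ℕ} (W : EE m → ℝ) (hW : Continuous W) (hW0 : ∀ v, 0 ≤ W v) (u : EE 2 → EE m)
    (hu : ContDiff ℝ 2 u) (hmin : GloballyMinimizing W u)
    (v : EE 2 → EE m) (R : ℝ) (K : ℝ) (hK : 0 ≤ K)
    (hlip : ∀ x y, ‖(v x - u x) - (v y - u y)‖ ≤ K * ‖x - y‖)
    (hsupp : ∀ x, x ∉ closedBall (0 : EE 2) R → v x = u x)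
    (g : EE 2 → ℝ) (hg : IntegrableOn g (ball 0 (R + 1)))
    (hle : ∀ x, (1 / 2) * gradSq v x + W (v x) ≤ (1 / 2) * gradSq u x + W (u x) - g x) :
    ∫ x in ball 0 (R + 1), g x ≤ 0 := by
  have h1 := hmin (ball 0 (R + 1)) isOpen_ball isBounded_ball (v - u)
    ⟨⟨K, hK⟩, LipschitzWith.of_dist_le_mul fun x y => by
      rw [dist_eq_norm, dist_eq_norm]; exact hlip x y⟩ ?_
  · have huv : u + (v - u) = v := by abel
    rw [huv] at h1
    unfold energy at h1
    have hiu := intOn_of_cont (eD_cont W hW u hu) (isBounded_ball (x := (0 : EE 2)) (r := R + 1))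
    have h2 : ∫ x in ball (0 : EE 2) (R + 1), ((1 / 2) * gradSq v x + W (v x)) ≤
        ∫ x in ball (0 : EE 2) (R + 1), ((1 / 2) * gradSq u x + W (u x) - g x) := by
      refine integral_mono_of_nonneg ?_ (hiu.sub hg) ?_
      · exact Eventually.of_forall fun x => by
          have := gradSq_nonneg' v x
          have := hW0 (v x)
          simp only [Pi.zero_apply]
          positivity
      · exact Eventually.of_forall hle
    rw [integral_sub hiu hg] at h2
    linarith
  · refine (closure_minimal (t := closedBall (0 : EE 2) R) ?_ isClosed_closedBall).trans
      (closedBall_subset_ball (by linarith))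
    intro x hx
    by_contra hc
    exact hx (by simp [hsupp x hc])

lemma gradSq_mono {m : ℕ} (u v : EE 2 → EE m) (x : EE 2) (hu : ContDiff ℝ 2 u)
    (h : ∀ᶠ y in nhds x, ‖v y - v x‖ ≤ ‖u y - u x‖) : gradSq v x ≤ gradSq u x := by
  unfold gradSq
  refine Finset.sum_le_sum fun i _ => ?_
  have := fderiv_bound u v x _ (single_norm i) (hu.differentiable (by norm_num) x)
    (fun _ => 1) (fun _ => 0) continuousAt_const continuousAt_const (by norm_num) le_rfl
    (by filter_upwards [h] with y hy; simpa using hy)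
  gcongr
  simpa using this

lemma replacement {m : ℕ} (W : EE m → ℝ) (hW : Continuous W) (a : EE m) (hWa : W a = 0)
    (hWpos : ∀ v, v ≠ a → 0 < W v) (hW0 : ∀ v, 0 ≤ W v) (r₀ r : ℝ) (hr0 : 0 < r)
    (hr : 2 * r ≤ r₀)
    (hmono : ∀ ν : EE m, ‖ν‖ = 1 →
      MonotoneOn (fun r : ℝ => W (a + r • ν)) (Set.Ioc 0 r₀))
    (u : EE 2 → EE m) (hu : ContDiff ℝ 2 u) (hmin : GloballyMinimizing W u)
    (K : Set (EE 2)) (hK : IsCompact K) (hfr : ∀ x ∈ frontier K, ‖u x - a‖ ≤ r) :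
    ∀ x ∈ K, ‖u x - a‖ ≤ 2 * r := by
  classical
  set Φ : EE m → EE m := fun y => a + cutR r (y - a) with hΦ
  have Φlip : ∀ x y, ‖Φ x - Φ y‖ ≤ ‖x - y‖ := by
    intro x y
    have := cutR_lip r (x - a) (y - a)
    simpa [hΦ] using this
  have Φid : ∀ y, ‖y - a‖ ≤ r → Φ y = y := by
    intro y hy
    simp [hΦ, cutR_small r _ hy]
  set v : EE 2 → EE m := fun x => if x ∈ K then Φ (u x) else u x with hv
  obtain ⟨R, hR⟩ := hK.isBounded.subset_closedBall 0
  obtain ⟨L, hL0, hL⟩ := lip_ball u hu R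
  have hfrK : frontier K ⊆ K := hK.isClosed.frontier_subset
  have hin : ∀ x ∈ K, ∀ y ∈ K, ‖(v x - u x) - (v y - u y)‖ ≤ 2 * L * ‖x - y‖ := by
    intro x hx y hy
    simp only [hv, if_pos hx, if_pos hy]
    have e1 := Φlip (u x) (u y)
    have e2 := hL x (hR hx) y (hR hy)
    calc ‖Φ (u x) - u x - (Φ (u y) - u y)‖ = ‖(Φ (u x) - Φ (u y)) - (u x - u y)‖ := by
          congr 1; abel
      _ ≤ ‖Φ (u x) - Φ (u y)‖ + ‖u x - u y‖ := norm_sub_le _ _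
      _ ≤ _ := by linarith
  have hfr0 : ∀ x ∈ frontier K, v x = u x := by
    intro x hx
    simp only [hv, if_pos (hfrK hx)]
    exact Φid _ (hfr x hx)
  have hmix : ∀ x ∈ K, ∀ y ∉ K, ‖v x - u x‖ ≤ 2 * L * ‖x - y‖ := by
    intro x hx y hy
    have hex : ∃ z ∈ segment ℝ x y, z ∈ frontier K := by
      by_contra hno
      push Not at hno
      obtain ⟨z, -, hz1, hz2⟩ := (convex_segment (𝕜 := ℝ) x y).isPreconnected (interior K) Kᶜ
        isOpen_interior hK.isClosed.isOpen_compl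
        (by
          intro z hz
          by_cases hzK : z ∈ K
          · left
            by_contra hzi
            exact hno z hz ⟨subset_closure hzK, hzi⟩
          · exact Or.inr hzK)
        ⟨x, left_mem_segment ℝ x y, by
          by_contra hzi
          exact hno x (left_mem_segment ℝ x y) ⟨subset_closure hx, hzi⟩⟩
        ⟨y, right_mem_segment ℝ x y, hy⟩
      exact hz2 (interior_subset hz1)
    obtain ⟨z, hz, hzf⟩ := hex
    have h1 := hin x hx z (hfrK hzf)
    rw [hfr0 z hzf, sub_self, sub_zero] at h1
    refine h1.trans ?_
    have : ‖x - z‖ ≤ ‖x - y‖ := by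
      have := mem_segment_iff_wbtw.1 hz
      have := this.dist_add_dist
      rw [← dist_eq_norm, ← dist_eq_norm]
      linarith [dist_nonneg (x := z) (y := y)]
    gcongr
  have hlip : ∀ x y, ‖(v x - u x) - (v y - u y)‖ ≤ 2 * L * ‖x - y‖ := by
    intro x y
    by_cases hx : x ∈ K <;> by_cases hy : y ∈ K
    · exact hin x hx y hy
    · have : v y = u y := by simp only [hv, if_neg hy]
      rw [this, sub_self, sub_zero]; exact hmix x hx y hy
    · have : v x = u x := by simp only [hv, if_neg hx]
      rw [this, sub_self, zero_sub, norm_neg, norm_sub_rev x y]; exact hmix y hy x hx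
    · have h1 : v y = u y := by simp only [hv, if_neg hy]
      have h2 : v x = u x := by simp only [hv, if_neg hx]
      rw [h1, h2, sub_self, sub_self, sub_self, norm_zero]; positivity
  have hgrad : ∀ x, gradSq v x ≤ gradSq u x := by
    intro x
    apply gradSq_mono u v x hu
    by_cases hxK : x ∈ K
    · by_cases hxi : x ∈ interior K
      · filter_upwards [isOpen_interior.mem_nhds hxi] with y hy
        simp only [hv, if_pos hxK, if_pos (interior_subset hy)]
        exact Φlip _ _
      · have hxf : x ∈ frontier K := ⟨subset_closure hxK, hxi⟩
        refine Eventually.of_forall fun y => ?_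
        rw [hfr0 x hxf]
        by_cases hy : y ∈ K
        · simp only [hv, if_pos hy]
          have := Φlip (u y) (u x)
          rwa [Φid _ (hfr x hxf)] at this
        · simp only [hv, if_neg hy]; exact le_rfl
    · filter_upwards [hK.isClosed.isOpen_compl.mem_nhds hxK] with y hy
      have hy' : y ∉ K := hy
      simp only [hv, if_neg hxK, if_neg hy']; exact le_rfl
  intro x0 hx0
  by_contra hcon
  push Not at hcon
  set B : Set (EE 2) := interior K ∩ {x | 2 * r < ‖u x - a‖} with hB
  have hBo : IsOpen B := isOpen_interior.inter
    (isOpen_lt continuous_const (hu.continuous.sub continuous_const).norm)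
  have hx0B : x0 ∈ B := by
    refine ⟨?_, hcon⟩
    by_contra hni
    have := hfr x0 ⟨subset_closure hx0, hni⟩
    linarith
  have hBR : B ⊆ ball 0 (R + 1) := fun x hx =>
    closedBall_subset_ball (by linarith) (hR (interior_subset hx.1))
  have hcW : Continuous fun x => W (u x) := hW.comp hu.continuous
  have hgi : IntegrableOn (B.indicator fun x => W (u x)) (ball 0 (R + 1)) :=
    (intOn_of_cont hcW isBounded_ball).indicator hBo.measurableSet
  have hfin := energy_compare W hW hW0 u hu hmin v R (2 * L) (by positivity) hlip
    (fun x hx => by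
      have : x ∉ K := fun h => hx (hR h)
      simp only [hv, if_neg this])
    (B.indicator fun x => W (u x)) hgi ?_
  · rw [setIntegral_indicator hBo.measurableSet, Set.inter_eq_right.2 hBR] at hfin
    have hpos : 0 < ∫ x in B, W (u x) := by
      rw [setIntegral_pos_iff_support_of_nonneg_ae
        (Eventually.of_forall fun x => hW0 (u x))
        (intOn_of_cont hcW (isBounded_ball.subset hBR))]
      refine lt_of_lt_of_le (hBo.measure_pos volume ⟨x0, hx0B⟩) (measure_mono ?_)
      intro x hx
      refine ⟨?_, hx⟩
      apply ne_of_gt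
      apply hWpos
      intro h
      have := hx.2
      rw [Set.mem_ofPred_eq, h, sub_self, norm_zero] at this
      linarith
    linarith
  · intro x
    have h1 := hgrad x
    by_cases hxB : x ∈ B
    · rw [Set.indicator_of_mem hxB]
      have : v x = a := by
        simp only [hv, if_pos (interior_subset hxB.1), hΦ]
        rw [cutR_large r _ (le_of_lt hxB.2), add_zero]
      rw [this, hWa]; linarith
    · rw [Set.indicator_of_notMem hxB]
      have : W (v x) ≤ W (u x) := by
        by_cases hx : x ∈ K
        · simp only [hv, if_pos hx]
          exact W_cutR W a hWa hW0 r₀ r hr hmono (u x)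
        · simp only [hv, if_neg hx]; exact le_rfl
      linarith

/-- Cut-off function. -/
noncomputable def etaR (R : ℝ) (x : EE 2) : ℝ := max 0 (min 1 (R + 1 - ‖x‖))

lemma etaR_nonneg (R : ℝ) (x : EE 2) : 0 ≤ etaR R x := le_max_left _ _
lemma etaR_le_one (R : ℝ) (x : EE 2) : etaR R x ≤ 1 := max_le zero_le_one (min_le_left _ _)
lemma etaR_cont (R : ℝ) : Continuous (etaR R) := by unfold etaR; fun_prop
lemma etaR_lip (R : ℝ) (x y : EE 2) : |etaR R x - etaR R y| ≤ ‖x - y‖ := by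
  unfold etaR
  refine (abs_max_sub_max_le_max _ _ _ _).trans (max_le (by simp) ?_)
  refine (abs_min_sub_min_le_max _ _ _ _).trans (max_le (by simp) ?_)
  have := abs_norm_sub_norm_le x y
  rw [abs_sub_comm] at this
  have e : R + 1 - ‖x‖ - (R + 1 - ‖y‖) = ‖y‖ - ‖x‖ := by ring
  rwa [e]
lemma etaR_one (R : ℝ) (x : EE 2) (hx : ‖x‖ < R) : etaR R x = 1 := by
  unfold etaR
  rw [min_eq_left (by linarith)]; norm_num
lemma etaR_zero (R : ℝ) (x : EE 2) (hx : R + 1 ≤ ‖x‖) : etaR R x = 0 := by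
  unfold etaR
  exact max_eq_left ((min_le_right _ _).trans (by linarith))

lemma etaR_sq_lip (R : ℝ) (x y : EE 2) :
    |etaR R x ^ 2 - etaR R y ^ 2| ≤ (etaR R x + etaR R y) * ‖x - y‖ := by
  have h := etaR_lip R x y
  have h1 := etaR_nonneg R x
  have h2 := etaR_nonneg R y
  rw [sq_sub_sq, abs_mul, abs_of_nonneg (by positivity)]
  gcongr

lemma key_ineq {m : ℕ} (W : EE m → ℝ) (hW : Continuous W) (a : EE m) (hWa : W a = 0)
    (hW0 : ∀ v, 0 ≤ W v)
    (u : EE 2 → EE m) (hu : ContDiff ℝ 2 u) (hmin : GloballyMinimizing W u)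
    (M : ℝ) (hM : ∀ x, ‖u x - a‖ ≤ M) (ε C : ℝ)
    (hC : ∀ y, ∀ s : ℝ, ‖y - a‖ ≤ M → 0 ≤ s → s ≤ 1 →
      12 * ‖y - a‖ ^ 2 + W (a + s • (y - a)) ≤ ε + C * W y) (R : ℝ) :
    ∫ x in ball 0 R, ((1 / 2) * gradSq u x + W (u x)) ≤
      ∫ x in ball 0 (R + 1) \ ball 0 R, (ε + C * W (u x)) := by
  have hM0 : 0 ≤ M := (norm_nonneg _).trans (hM 0)
  set v : EE 2 → EE m := fun x => a + (1 - etaR R x ^ 2) • (u x - a) with hv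
  set A : Set (EE 2) := ball 0 (R + 1) \ ball 0 R with hA
  have hAm : MeasurableSet A := measurableSet_ball.diff measurableSet_ball
  obtain ⟨L, hL0, hL⟩ := lip_ball u hu (R + 1)
  have hz1 : ∀ x, etaR R x ^ 2 ≤ 1 := fun x => pow_le_one₀ (etaR_nonneg R x) (etaR_le_one R x)
  have hdz : ∀ x y, |etaR R x ^ 2 - etaR R y ^ 2| ≤ 2 * ‖x - y‖ := by
    intro x y
    refine (etaR_sq_lip R x y).trans ?_
    have := etaR_le_one R x
    have := etaR_le_one R y
    gcongr
    linarith
  have hvu : ∀ x, v x - u x = -(etaR R x ^ 2 • (u x - a)) := by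
    intro x
    simp only [hv]
    module
  have hzero : ∀ x y, etaR R y = 0 → ‖etaR R x ^ 2 • (u x - a)‖ ≤ 2 * ‖x - y‖ * M := by
    intro x y h
    have := hdz x y
    rw [h] at this
    rw [norm_smul, Real.norm_eq_abs]
    simp only [ne_eq, OfNat.ofNat_ne_zero, not_false_eq_true, zero_pow, sub_zero] at this
    exact mul_le_mul this (hM x) (norm_nonneg _) (by positivity)
  have hlip : ∀ x y, ‖(v x - u x) - (v y - u y)‖ ≤ (2 * M + L) * ‖x - y‖ := by
    intro x y
    rw [hvu, hvu]
    have hd := norm_nonneg (x - y)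
    have hLd : 0 ≤ L * ‖x - y‖ := by positivity
    by_cases hy : etaR R y = 0
    · have h := hzero x y hy
      rw [hy]
      simp only [ne_eq, OfNat.ofNat_ne_zero, not_false_eq_true, zero_pow, zero_smul, neg_zero,
        sub_zero, norm_neg]
      linarith
    by_cases hx : etaR R x = 0
    · have h := hzero y x hx
      rw [norm_sub_rev y x] at h
      rw [hx]
      simp only [ne_eq, OfNat.ofNat_ne_zero, not_false_eq_true, zero_pow, zero_smul, neg_zero,
        zero_sub, norm_neg]
      linarith
    have hxb : x ∈ closedBall (0 : EE 2) (R + 1) := by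
      rw [mem_closedBall_zero_iff]
      by_contra hc
      exact hx (etaR_zero R x (by linarith))
    have hyb : y ∈ closedBall (0 : EE 2) (R + 1) := by
      rw [mem_closedBall_zero_iff]
      by_contra hc
      exact hy (etaR_zero R y (by linarith))
    have e1 := hL x hxb y hyb
    calc ‖-(etaR R x ^ 2 • (u x - a)) - -(etaR R y ^ 2 • (u y - a))‖
        = ‖(etaR R y ^ 2 - etaR R x ^ 2) • (u x - a) - etaR R y ^ 2 • (u x - u y)‖ := by
          congr 1; module
      _ ≤ ‖(etaR R y ^ 2 - etaR R x ^ 2) • (u x - a)‖ + ‖etaR R y ^ 2 • (u x - u y)‖ :=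
          norm_sub_le _ _
      _ ≤ 2 * ‖x - y‖ * M + 1 * (L * ‖x - y‖) := by
          rw [norm_smul, norm_smul, Real.norm_eq_abs, Real.norm_of_nonneg (sq_nonneg _)]
          have h1 := hdz y x
          rw [norm_sub_rev y x] at h1
          have h2 := hM x
          have h3 := hz1 y
          gcongr
      _ = _ := by ring
  have hfd : ∀ x (i : Fin 2), ‖fderiv ℝ v x (EuclideanSpace.single i 1)‖ ≤
      (1 - etaR R x ^ 2) * ‖fderiv ℝ u x (EuclideanSpace.single i 1)‖
        + 2 * etaR R x * ‖u x - a‖ := by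
    intro x i
    have hc := etaR_cont R
    have := fderiv_bound u v x _ (single_norm i) (hu.differentiable (by norm_num) x)
      (fun y => 1 - etaR R y ^ 2) (fun y => (etaR R y + etaR R x) * ‖u x - a‖)
      (by fun_prop) (by fun_prop) (by linarith [hz1 x])
      (by have := etaR_nonneg R x; positivity)
      (Eventually.of_forall fun y => ?_)
    · simpa [two_mul] using this
    · calc ‖v y - v x‖
          = ‖(1 - etaR R y ^ 2) • (u y - u x) - (etaR R y ^ 2 - etaR R x ^ 2) • (u x - a)‖ := by
            congr 1; simp only [hv]; module
        _ ≤ ‖(1 - etaR R y ^ 2) • (u y - u x)‖ + ‖(etaR R y ^ 2 - etaR R x ^ 2) • (u x - a)‖ :=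
            norm_sub_le _ _
        _ ≤ (1 - etaR R y ^ 2) * ‖u y - u x‖ +
              ((etaR R y + etaR R x) * ‖y - x‖) * ‖u x - a‖ := by
            rw [norm_smul, norm_smul, Real.norm_eq_abs (etaR R y ^ 2 - etaR R x ^ 2),
              Real.norm_of_nonneg (by linarith [hz1 y])]
            have := etaR_sq_lip R y x
            gcongr
        _ = _ := by ring
  have hgrad : ∀ x, gradSq v x ≤ gradSq u x + 24 * ‖u x - a‖ ^ 2 := by
    intro x
    unfold gradSq
    rw [Fin.sum_univ_two, Fin.sum_univ_two]
    have hone : ∀ i : Fin 2, ‖fderiv ℝ v x (EuclideanSpace.single i 1)‖ ^ 2 ≤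
        ‖fderiv ℝ u x (EuclideanSpace.single i 1)‖ ^ 2 + 12 * ‖u x - a‖ ^ 2 := by
      intro i
      have h := hfd x i
      set p := ‖fderiv ℝ u x (EuclideanSpace.single i 1)‖
      set q := ‖u x - a‖
      set t := etaR R x with ht
      have ht0 : 0 ≤ t := etaR_nonneg R x
      have ht1 : t ≤ 1 := etaR_le_one R x
      have hp : 0 ≤ p := norm_nonneg _
      have hq : 0 ≤ q := norm_nonneg _
      have ht2 : t ^ 2 ≤ 1 := hz1 x
      have ht20 : 0 ≤ t ^ 2 := sq_nonneg t
      have h2 : ‖fderiv ℝ v x (EuclideanSpace.single i 1)‖ ^ 2 ≤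
          ((1 - t ^ 2) * p + 2 * t * q) ^ 2 := by gcongr
      refine h2.trans ?_
      have c1 : (1 - t ^ 2) * (t * q * p) ≤ 1 * (t * q * p) := by
        have : 0 ≤ t * q * p := by positivity
        apply mul_le_mul_of_nonneg_right _ this
        linarith
      have c2 : 4 * (t * q * p) ≤ t ^ 2 * p ^ 2 / 2 + 8 * q ^ 2 := by
        nlinarith [sq_nonneg (t * p - 4 * q)]
      have c3 : t ^ 2 * q ^ 2 ≤ 1 * q ^ 2 := by gcongr
      have c4 : (1 - t ^ 2) ^ 2 * p ^ 2 ≤ (1 - t ^ 2) * p ^ 2 := by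
        have : (1 - t ^ 2) ^ 2 ≤ 1 - t ^ 2 := by nlinarith
        gcongr
      have c5 : 0 ≤ t ^ 2 * p ^ 2 := by positivity
      nlinarith
    linarith [hone 0, hone 1]
  have hcont := eD_cont W hW u hu
  have hcont2 : Continuous fun x => ε + C * W (u x) := by
    have := hu.continuous
    fun_prop
  have hsub : ball (0 : EE 2) R ⊆ ball 0 (R + 1 + 1) := ball_subset_ball (by linarith)
  have hsub2 : A ⊆ ball (0 : EE 2) (R + 1 + 1) :=
    Set.sdiff_subset.trans (ball_subset_ball (by linarith))
  have hi1 : IntegrableOn ((ball (0 : EE 2) R).indicator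
      fun x => (1 / 2) * gradSq u x + W (u x)) (ball 0 (R + 1 + 1)) :=
    (intOn_of_cont hcont isBounded_ball).indicator measurableSet_ball
  have hi2 : IntegrableOn (A.indicator fun x => ε + C * W (u x)) (ball 0 (R + 1 + 1)) :=
    (intOn_of_cont hcont2 isBounded_ball).indicator hAm
  have hfin := energy_compare W hW hW0 u hu hmin v (R + 1) (2 * M + L) (by positivity) hlip
    (fun x hx => by
      rw [mem_closedBall_zero_iff] at hx
      simp [hv, etaR_zero R x (by linarith)])
    (fun x => (ball (0 : EE 2) R).indicator (fun x => (1 / 2) * gradSq u x + W (u x)) x -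
      A.indicator (fun x => ε + C * W (u x)) x) (hi1.sub hi2) ?_
  · rw [integral_sub hi1 hi2, setIntegral_indicator measurableSet_ball,
      setIntegral_indicator hAm, Set.inter_eq_right.2 hsub, Set.inter_eq_right.2 hsub2] at hfin
    linarith
  · intro x
    by_cases hx : x ∈ ball (0 : EE 2) R
    · have hxA : x ∉ A := fun h => h.2 hx
      rw [Set.indicator_of_mem hx, Set.indicator_of_notMem hxA]
      have hloc : v =ᶠ[nhds x] fun _ => a := by
        filter_upwards [isOpen_ball.mem_nhds hx] with y hy
        rw [mem_ball_zero_iff] at hy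
        simp [hv, etaR_one R y hy]
      have h1 : gradSq v x = 0 := by
        unfold gradSq
        rw [hloc.fderiv_eq]
        simp
      rw [h1, hloc.eq_of_nhds, hWa]
      linarith
    · rw [Set.indicator_of_notMem hx]
      by_cases hxA : x ∈ A
      · rw [Set.indicator_of_mem hxA]
        have h1 := hgrad x
        have h2 := hC (u x) (1 - etaR R x ^ 2) (hM x) (by linarith [hz1 x])
          (by linarith [sq_nonneg (etaR R x)])
        have h3 := hW0 (u x)
        have h4 : W (v x) = W (a + (1 - etaR R x ^ 2) • (u x - a)) := rfl
        linarith
      · rw [Set.indicator_of_notMem hxA]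
        have hxn : R + 1 ≤ ‖x‖ := by
          by_contra hc
          exact hxA ⟨by rw [mem_ball_zero_iff]; linarith, hx⟩
        have hz := etaR_zero R x hxn
        have h1 : gradSq v x ≤ gradSq u x := by
          unfold gradSq
          refine Finset.sum_le_sum fun i _ => ?_
          have := hfd x i
          rw [hz] at this
          gcongr
          simpa using this
        have h2 : v x = u x := by simp [hv, hz]
        rw [h2]; linarith

lemma vol_annulus (R : ℝ) (hR : 0 ≤ R) :
    volume.real (ball (0 : EE 2) (R + 1) \ ball 0 R) = Real.pi * (2 * R + 1) := by
  rw [measureReal_sdiff (ball_subset_ball (by linarith)) measurableSet_ball]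
  simp only [Measure.real, EuclideanSpace.volume_ball_fin_two, ENNReal.toReal_mul,
    ENNReal.toReal_pow, ENNReal.toReal_ofReal hR, ENNReal.toReal_ofReal Real.pi_pos.le,
    ENNReal.toReal_ofReal (by linarith : 0 ≤ R + 1)]
  ring

lemma energy_small {m : ℕ} (W : EE m → ℝ) (hW : Continuous W) (a : EE m) (hWa : W a = 0)
    (hWpos : ∀ v, v ≠ a → 0 < W v)
    (hW0 : ∀ v, 0 ≤ W v)
    (u : EE 2 → EE m) (hu : ContDiff ℝ 2 u) (hmin : GloballyMinimizing W u)
    (M : ℝ) (hM : ∀ x, ‖u x - a‖ ≤ M) (ε : ℝ) (hε : 0 < ε) :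
    ∀ᶠ N : ℕ in atTop,
      ∫ x in ball 0 (N : ℝ), ((1 / 2) * gradSq u x + W (u x)) ≤ ε * N := by
  set E : ℝ → ℝ := fun R => ∫ x in ball (0 : EE 2) R, ((1 / 2) * gradSq u x + W (u x)) with hE
  set F : ℝ → ℝ := fun R => ∫ x in ball (0 : EE 2) R, W (u x) with hF
  have hcW : Continuous fun x => W (u x) := hW.comp hu.continuous
  have hcE := eD_cont W hW u hu
  have hFE : ∀ R, F R ≤ E R := fun R => by
    refine setIntegral_mono (intOn_of_cont hcW isBounded_ball)
      (intOn_of_cont hcE isBounded_ball) fun x => ?_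
    have := gradSq_nonneg' u x
    simp only
    linarith
  have hF0 : ∀ R, 0 ≤ F R := fun R => integral_nonneg fun x => hW0 _
  have hEmono : ∀ R S, R ≤ S → E R ≤ E S := fun R S h =>
    setIntegral_mono_set (intOn_of_cont hcE isBounded_ball)
      (Eventually.of_forall fun x => by
        have := gradSq_nonneg' u x
        have := hW0 (u x)
        simp only [Pi.zero_apply]
        positivity) (ball_subset_ball h).eventuallyLE
  have hFd : ∀ R, ∫ x in ball (0 : EE 2) (R + 1) \ ball 0 R, W (u x) = F (R + 1) - F R :=
    fun R => setIntegral_sdiff measurableSet_ball (intOn_of_cont hcW isBounded_ball)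
      (ball_subset_ball (by linarith))
  have key : ∀ ε > 0, ∃ C, 0 ≤ C ∧ ∀ R, 0 ≤ R →
      E R ≤ ε * (Real.pi * (2 * R + 1)) + C * (F (R + 1) - F R) := by
    intro ε hε
    obtain ⟨C, hC0, hC⟩ := W_interp W a hW hWa hWpos M ε hε
    refine ⟨C, hC0, fun R hR => ?_⟩
    have h := key_ineq W hW a hWa hW0 u hu hmin M hM ε C hC R
    have hb : Bornology.IsBounded (ball (0 : EE 2) (R + 1) \ ball 0 R) :=
      isBounded_ball.subset Set.sdiff_subset
    have hcC : Continuous fun x => C * W (u x) := continuous_const.mul hcW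
    rw [integral_add (intOn_of_cont continuous_const hb) (intOn_of_cont hcC hb), integral_const_mul, hFd,
      setIntegral_const, vol_annulus R hR, smul_eq_mul] at h
    linarith
  -- linear bound
  obtain ⟨B, hB0, hB⟩ := W_upper W a hW M
  obtain ⟨C1, hC10, hC1⟩ := key 1 one_pos
  have hlin : ∀ R, 0 ≤ R → E R ≤ (1 + C1 * B) * (Real.pi * (2 * R + 1)) := by
    intro R hR
    have h := hC1 R hR
    have hb : Bornology.IsBounded (ball (0 : EE 2) (R + 1) \ ball 0 R) :=
      isBounded_ball.subset Set.sdiff_subset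
    have h2 : F (R + 1) - F R ≤ B * (Real.pi * (2 * R + 1)) := by
      rw [← hFd]
      have := setIntegral_mono (μ := volume) (intOn_of_cont hcW hb)
        (intOn_of_cont (continuous_const (y := B)) hb) (fun x => hB (u x) (hM x))
      rw [setIntegral_const, vol_annulus R hR, smul_eq_mul] at this
      linarith
    have h3 := mul_le_mul_of_nonneg_left h2 hC10
    linarith
  set D := (1 + C1 * B) * Real.pi with hD
  have hpi := Real.pi_pos
  have hD0 : 0 < D := by positivity
  obtain ⟨C, hC0, hC⟩ := key (ε / (10 * Real.pi)) (by positivity)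
  filter_upwards [eventually_ge_atTop 1, eventually_ge_atTop ⌈10 * C * D / ε⌉₊] with N hN1 hN2
  have hN1' : (1 : ℝ) ≤ N := by exact_mod_cast hN1
  have hN2' : 10 * C * D / ε ≤ N := (Nat.le_ceil _).trans (by exact_mod_cast hN2)
  have hsum : ∑ j ∈ Finset.range N, E N ≤ ∑ j ∈ Finset.range N,
      (ε / 10 * (4 * N + 1) + C * (F ((N + (j + 1 : ℕ) : ℝ)) - F ((N + (j : ℕ) : ℝ)))) := by
    refine Finset.sum_le_sum fun j hj => ?_
    have hj' : (j : ℝ) ≤ N := by exact_mod_cast (Finset.mem_range.1 hj).le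
    have h1 := hEmono N (N + j) (by linarith [Nat.cast_nonneg (α := ℝ) j])
    have h2 := hC (N + j) (by positivity)
    have h3 : ε / (10 * Real.pi) * (Real.pi * (2 * (N + j) + 1)) = ε / 10 * (2 * (N + j) + 1) := by
      field_simp
    have h4 : ε / 10 * (2 * (N + j) + 1) ≤ ε / 10 * (4 * N + 1) := by
      apply mul_le_mul_of_nonneg_left _ (by positivity)
      linarith
    push_cast
    rw [← add_assoc]
    linarith
  rw [Finset.sum_add_distrib, ← Finset.mul_sum (f := fun j : ℕ => F ((N : ℝ) + ((j + 1 : ℕ) : ℝ)) -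
    F ((N : ℝ) + (j : ℝ))), Finset.sum_range_sub
    (fun j : ℕ => F ((N : ℝ) + (j : ℝ))), Finset.sum_const, Finset.sum_const, Finset.card_range,
    nsmul_eq_mul, nsmul_eq_mul] at hsum
  have h5 : F (N + N) ≤ D * (5 * N) := by
    refine (hFE _).trans ((hlin _ (by positivity)).trans ?_)
    rw [hD, mul_assoc]
    gcongr
    linarith
  have h6 : C * (F (N + N) - F (N + (0 : ℕ))) ≤ C * (D * (5 * N)) := by
    gcongr
    linarith [hF0 (N + (0 : ℕ))]
  have h7 : 10 * C * D ≤ N * ε := (div_le_iff₀ hε).1 hN2'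
  have h8 : (N : ℝ) * E N ≤ N * (ε * N) := by
    have h9 : (N : ℝ) * (ε / 10 * (4 * N + 1)) ≤ N * (ε / 10 * (5 * N)) := by
      gcongr; linarith
    have h10 : C * (D * (5 * N)) ≤ N * (ε * N) / 2 := by
      have := mul_le_mul_of_nonneg_right h7 (by positivity : (0 : ℝ) ≤ N / 2)
      linarith
    refine hsum.trans ((add_le_add h9 (h6.trans h10)).trans (le_of_eq ?_))
    ring
  exact le_of_mul_le_mul_left h8 (by linarith)

lemma line_exists (f : EE 2 → ℝ) (hf : Continuous f) (hf0 : ∀ x, 0 ≤ f x) (g : ℝ × ℝ → EE 2)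
    (hg : MeasurePreserving g volume volume) (hgc : Continuous g)
    (hgn : ∀ p, ‖g p‖ ^ 2 = p.1 ^ 2 + p.2 ^ 2) (R : ℝ) (hR : 0 < R) :
    ∃ s ∈ Set.Icc R (2 * R), ∫ y in Set.Icc (-(2 * R)) (2 * R), f (g (s, y)) ≤
      (∫ x in ball 0 (3 * R), f x) / R := by
  have hfg : Continuous fun p => f (g p) := hf.comp hgc
  set I := Set.Icc R (2 * R) with hI
  set J := Set.Icc (-(2 * R)) (2 * R) with hJ
  have hIJ : IsCompact (I ×ˢ J) := isCompact_Icc.prod isCompact_Icc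
  have hInt1 : IntegrableOn (fun p => f (g p)) (I ×ˢ J) (volume.prod volume) := by
    rw [← Measure.volume_eq_prod]
    exact hfg.continuousOn.integrableOn_compact hIJ
  have h1 : ∫ p in I ×ˢ J, f (g p) = ∫ x in I, ∫ y in J, f (g (x, y)) := by
    rw [Measure.volume_eq_prod]
    exact setIntegral_prod _ hInt1
  have hsub : I ×ˢ J ⊆ g ⁻¹' ball 0 (3 * R) := by
    rintro ⟨x, y⟩ ⟨hx, hy⟩
    simp only [hI, hJ, Set.mem_Icc] at hx hy
    rw [Set.mem_preimage, mem_ball_zero_iff]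
    have h := hgn (x, y)
    simp only at h
    refine lt_of_pow_lt_pow_left₀ 2 (by positivity) ?_
    rw [h]
    nlinarith
  have hmp := hg.restrict_preimage (s := ball (0 : EE 2) (3 * R)) measurableSet_ball
  have h2 : ∫ x in ball 0 (3 * R), f x = ∫ p in g ⁻¹' ball 0 (3 * R), f (g p) := by
    rw [← hmp.map_eq, integral_map hmp.measurable.aemeasurable hf.aestronglyMeasurable]
  have hint2 : IntegrableOn (fun p => f (g p)) (g ⁻¹' ball 0 (3 * R)) := by
    have := intOn_of_cont hf (isBounded_ball (x := (0 : EE 2)) (r := 3 * R))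
    exact hmp.integrable_comp_of_integrable this
  have h3 : ∫ p in I ×ˢ J, f (g p) ≤ ∫ x in ball 0 (3 * R), f x := by
    rw [h2]
    exact setIntegral_mono_set hint2 (Eventually.of_forall fun p => hf0 _) hsub.eventuallyLE
  have hint3 : IntegrableOn (fun x => ∫ y in J, f (g (x, y))) I := by
    have : Integrable (fun p => f (g p)) ((volume.restrict I).prod (volume.restrict J)) := by
      rw [Measure.prod_restrict]; exact hInt1
    exact this.integral_prod_left
  have hvI : volume I = ENNReal.ofReal R := by
    rw [hI, Real.volume_Icc]; congr 1; ring
  obtain ⟨s, hs, hle⟩ := exists_le_setAverage (μ := volume) (s := I)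
    (f := fun x => ∫ y in J, f (g (x, y))) (by rw [hvI]; simpa using hR)
    (by rw [hvI]; simp) hint3
  refine ⟨s, hs, hle.trans ?_⟩
  rw [setAverage_eq, Measure.real, hvI, ENNReal.toReal_ofReal hR.le, smul_eq_mul, ← h1,
    div_eq_inv_mul]
  gcongr

lemma one_dim {m : ℕ} (W : EE m → ℝ) (hW : Continuous W) (hW0 : ∀ v, 0 ≤ W v) (a : EE m)
    (M : ℝ) (r w : ℝ) (hr : 0 < r) (hw : 0 < w)
    (hwl : ∀ y, r / 2 ≤ ‖y - a‖ → ‖y - a‖ ≤ M → w ≤ W y)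
    (γ γ' : ℝ → EE m) (hγ : ∀ t, HasDerivAt γ (γ' t) t) (hγ' : Continuous γ')
    (hM : ∀ t, ‖γ t - a‖ ≤ M) (h : ℝ → ℝ) (hc : Continuous h)
    (hle : ∀ t, (1 / 2) * ‖γ' t‖ ^ 2 + W (γ t) ≤ h t)
    (T : ℝ) (hT : 1 ≤ T) (hε : ∫ t in Set.Icc (-T) T, h t ≤ min (r ^ 2 / 8) (w / 2)) :
    ∀ t ∈ Set.Icc (-T) T, ‖γ t - a‖ ≤ r := by
  intro t0 ht0
  by_contra hcon
  push Not at hcon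
  have hγc : Continuous γ := continuous_iff_continuousAt.2 fun t => (hγ t).continuousAt
  obtain ⟨c, hc1, hc2, hc3, hc4⟩ : ∃ c, -T ≤ c ∧ c + 1 ≤ T ∧ c ≤ t0 ∧ t0 ≤ c + 1 := by
    rcases le_total t0 0 with h0 | h0
    · exact ⟨t0, ht0.1, by linarith, le_rfl, by linarith⟩
    · exact ⟨t0 - 1, by linarith, by linarith [ht0.2], by linarith, by linarith⟩
  set I := Set.Icc c (c + 1) with hI
  have hh0 : ∀ t, 0 ≤ h t := fun t => by
    have h1 := hle t
    have h2 := hW0 (γ t)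
    have h3 : 0 ≤ (1 / 2) * ‖γ' t‖ ^ 2 := by positivity
    linarith
  have hci : ∀ {f : ℝ → ℝ}, Continuous f → IntegrableOn f I := fun hf =>
    hf.continuousOn.integrableOn_compact isCompact_Icc
  have hIle : ∫ t in I, h t ≤ min (r ^ 2 / 8) (w / 2) := by
    refine le_trans ?_ hε
    exact setIntegral_mono_set (hc.continuousOn.integrableOn_compact isCompact_Icc)
      (Eventually.of_forall hh0) (Set.Icc_subset_Icc hc1 hc2).eventuallyLE
  have hvol : volume.real I = 1 := by
    simp [Measure.real, hI]
  have hconst : ∀ k : ℝ, ∫ _ in I, k = k := fun k => by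
    rw [setIntegral_const, hvol]; simp
  have hnorm : ∫ t in I, ‖γ' t‖ ≤ r / 2 := by
    have hle2 : ∀ t, ‖γ' t‖ ≤ (2 / r) * h t + r / 4 := by
      intro t
      have h1 := hle t
      have h2 := hW0 (γ t)
      set p := ‖γ' t‖
      have h3 : p ≤ (2 / r) * ((1 / 2) * p ^ 2) + r / 4 := by
        have h5 : (2 / r) * ((1 / 2) * p ^ 2) + r / 4 - p = (p - r / 2) ^ 2 / r := by
          field_simp; ring
        have : 0 ≤ (p - r / 2) ^ 2 / r := by positivity
        linarith
      have h4 : (2 / r) * ((1 / 2) * p ^ 2) ≤ (2 / r) * h t := by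
        gcongr; linarith
      linarith
    have hcc : Continuous fun t => (2 / r) * h t := continuous_const.mul hc
    have h1 : ∫ t in I, ‖γ' t‖ ≤ ∫ t in I, ((2 / r) * h t + r / 4) :=
      setIntegral_mono (hci hγ'.norm) (hci (hcc.add continuous_const)) hle2
    rw [integral_add (hci hcc) (hci continuous_const), integral_const_mul, hconst] at h1
    have h2 : (2 / r) * ∫ t in I, h t ≤ (2 / r) * (r ^ 2 / 8) := by
      gcongr
      exact hIle.trans (min_le_left _ _)
    have h3 : (2 / r) * (r ^ 2 / 8) = r / 4 := by field_simp; norm_num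
    linarith
  have hfar : ∀ t ∈ I, r / 2 ≤ ‖γ t - a‖ := by
    intro t ht
    have h1 : ∫ s in t0..t, γ' s = γ t - γ t0 :=
      intervalIntegral.integral_eq_sub_of_hasDerivAt (fun s _ => hγ s)
        (hγ'.intervalIntegrable _ _)
    have h2 := intervalIntegral.norm_integral_le_integral_norm_uIoc (f := γ') (a := t0) (b := t)
      (μ := volume)
    have h3 : ∫ s in Set.uIoc t0 t, ‖γ' s‖ ≤ ∫ s in I, ‖γ' s‖ := by
      refine setIntegral_mono_set (hci hγ'.norm) (Eventually.of_forall fun _ => norm_nonneg _) ?_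
      have hss : Set.uIoc t0 t ⊆ I :=
        Set.uIoc_subset_uIcc.trans (Set.uIcc_subset_Icc ⟨hc3, hc4⟩ ht)
      exact hss.eventuallyLE
    rw [h1] at h2
    have h4 : ‖γ t0 - a‖ ≤ ‖γ t - a‖ + ‖γ t - γ t0‖ := by
      have : γ t0 - a = (γ t - a) - (γ t - γ t0) := by abel
      rw [this]; exact norm_sub_le _ _
    linarith
  have hlow : w ≤ ∫ t in I, h t := by
    rw [← hconst w]
    refine setIntegral_mono_on (hci continuous_const) (hci hc) measurableSet_Icc fun t ht => ?_
    have h1 := hwl _ (hfar t ht) (hM t)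
    have h2 := hle t
    have h3 : 0 ≤ (1 / 2) * ‖γ' t‖ ^ 2 := by positivity
    linarith
  have := hIle.trans (min_le_right _ _)
  linarith

/-- The four coordinate charts. -/
noncomputable def chA (p : ℝ × ℝ) : EE 2 := WithLp.toLp 2 ![p.1, p.2]

lemma chA_mp : MeasurePreserving chA volume volume :=
  (PiLp.volume_preserving_toLp (Fin 2)).comp (volume_preserving_finTwoArrow ℝ).symm

lemma chA_cont : Continuous chA := by
  unfold chA
  refine (PiLp.continuous_toLp 2 _).comp ?_
  refine continuous_pi fun i => ?_
  fin_cases i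
  · exact continuous_fst
  · exact continuous_snd

lemma chA_norm (p : ℝ × ℝ) : ‖chA p‖ ^ 2 = p.1 ^ 2 + p.2 ^ 2 := by
  rw [EuclideanSpace.norm_sq_eq, Fin.sum_univ_two]
  simp [chA]

lemma chA_eq (p : ℝ × ℝ) : chA p =
    p.1 • (EuclideanSpace.single 0 1 : EE 2) + p.2 • (EuclideanSpace.single 1 1 : EE 2) := by
  ext i
  fin_cases i <;> simp [chA]

lemma neg_fst_mp : MeasurePreserving (fun p : ℝ × ℝ => (-p.1, p.2)) volume volume :=
  (Measure.measurePreserving_neg (volume : Measure ℝ)).prod (MeasurePreserving.id volume)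

lemma swap_mp : MeasurePreserving (fun p : ℝ × ℝ => (p.2, p.1)) volume volume :=
  Measure.measurePreserving_swap

lemma good_line {m : ℕ} (W : EE m → ℝ) (hW : Continuous W) (hW0 : ∀ v, 0 ≤ W v) (a : EE m)
    (u : EE 2 → EE m) (hu : ContDiff ℝ 2 u)
    (M : ℝ) (hM : ∀ x, ‖u x - a‖ ≤ M) (r w : ℝ) (hr : 0 < r) (hw : 0 < w)
    (hwl : ∀ y, r / 2 ≤ ‖y - a‖ → ‖y - a‖ ≤ M → w ≤ W y)
    (g : ℝ × ℝ → EE 2)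
    (hg : MeasurePreserving g volume volume) (hgc : Continuous g)
    (hgn : ∀ p, ‖g p‖ ^ 2 = p.1 ^ 2 + p.2 ^ 2) (i : Fin 2)
    (hgd : ∀ s t, HasDerivAt (fun y => g (s, y)) (EuclideanSpace.single i 1 : EE 2) t)
    (R : ℝ) (hR : 1 ≤ R)
    (hε : ∫ x in ball 0 (3 * R), ((1 / 2) * gradSq u x + W (u x)) ≤
      min (r ^ 2 / 8) (w / 2) * R) :
    ∃ s ∈ Set.Icc R (2 * R), ∀ t ∈ Set.Icc (-(2 * R)) (2 * R), ‖u (g (s, t)) - a‖ ≤ r := by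
  have hcE := eD_cont W hW u hu
  have hR0 : 0 < R := by linarith
  obtain ⟨s, hs, hle⟩ := line_exists _ hcE (fun x => by
    have := gradSq_nonneg' u x
    have := hW0 (u x)
    positivity) g hg hgc hgn R hR0
  refine ⟨s, hs, ?_⟩
  have hgs : Continuous fun t : ℝ => g (s, t) := by fun_prop
  have hfd : Continuous (fderiv ℝ u) := hu.continuous_fderiv (by norm_num)
  refine one_dim W hW hW0 a M r w hr hw hwl (fun t => u (g (s, t)))
    (fun t => fderiv ℝ u (g (s, t)) (EuclideanSpace.single i 1)) (fun t => ?_) (by fun_prop)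
    (fun t => hM _) (fun t => (1 / 2) * gradSq u (g (s, t)) + W (u (g (s, t))))
    (hcE.comp hgs) (fun t => ?_) (2 * R) (by linarith) (hle.trans ((div_le_iff₀ hR0).2 hε))
  · exact ((hu.differentiable (by norm_num)) (g (s, t))).hasFDerivAt.comp_hasDerivAt t (hgd s t)
  · have : ‖fderiv ℝ u (g (s, t)) (EuclideanSpace.single i 1)‖ ^ 2 ≤ gradSq u (g (s, t)) := by
      unfold gradSq
      exact Finset.single_le_sum
        (f := fun i => ‖fderiv ℝ u (g (s, t)) (EuclideanSpace.single i 1)‖ ^ 2)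
        (fun _ _ => by positivity) (Finset.mem_univ i)
    linarith

lemma chA_deriv_snd (x : ℝ) (t : ℝ) :
    HasDerivAt (fun y => chA (x, y)) (EuclideanSpace.single 1 1 : EE 2) t := by
  simp only [chA_eq]
  have := ((hasDerivAt_id t).smul_const (EuclideanSpace.single 1 1 : EE 2)).const_add
    (x • (EuclideanSpace.single 0 1 : EE 2))
  simpa using this

lemma chA_deriv_fst (x : ℝ) (t : ℝ) :
    HasDerivAt (fun y => chA (y, x)) (EuclideanSpace.single 0 1 : EE 2) t := by
  simp only [chA_eq]
  have := ((hasDerivAt_id t).smul_const (EuclideanSpace.single 0 1 : EE 2)).add_const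
    (x • (EuclideanSpace.single 1 1 : EE 2))
  simpa using this

lemma chA_self (z : EE 2) : chA (z 0, z 1) = z := by
  ext i
  fin_cases i <;> simp [chA]

lemma final_step {m : ℕ} (W : EE m → ℝ) (hW : Continuous W) (a : EE m) (hWa : W a = 0)
    (hWpos : ∀ v, v ≠ a → 0 < W v) (hW0 : ∀ v, 0 ≤ W v) (r₀ r : ℝ) (hr : 0 < r)
    (hrr : 2 * r ≤ r₀)
    (hmono : ∀ ν : EE m, ‖ν‖ = 1 →
      MonotoneOn (fun r : ℝ => W (a + r • ν)) (Set.Ioc 0 r₀))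
    (u : EE 2 → EE m) (hu : ContDiff ℝ 2 u) (hmin : GloballyMinimizing W u)
    (M : ℝ) (hM : ∀ x, ‖u x - a‖ ≤ M) (x : EE 2) : ‖u x - a‖ ≤ 2 * r := by
  obtain ⟨w, hw, hwl⟩ := W_lower W a hW hWpos M (r / 2) (by positivity)
  have hε0 : 0 < min (r ^ 2 / 8) (w / 2) := lt_min (by positivity) (by positivity)
  have hE := energy_small W hW a hWa hWpos hW0 u hu hmin M hM (min (r ^ 2 / 8) (w / 2) / 3)
    (by positivity)
  obtain ⟨N0, hN0⟩ := eventually_atTop.1 hE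
  obtain ⟨N, hN1, hN2, hN3⟩ : ∃ N : ℕ, N0 ≤ N ∧ 1 ≤ N ∧ ‖x‖ ≤ N :=
    ⟨max N0 (max 1 ⌈‖x‖⌉₊), le_max_left _ _, (le_max_left _ _).trans (le_max_right _ _),
      (Nat.le_ceil _).trans (by exact_mod_cast (le_max_right _ _).trans (le_max_right _ _))⟩
  have hR : (1 : ℝ) ≤ N := by exact_mod_cast hN2
  have hsmall := hN0 (3 * N) (by omega)
  set R : ℝ := (N : ℝ) with hRdef
  have hsm : ∫ x in ball 0 (3 * R), ((1 / 2) * gradSq u x + W (u x)) ≤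
      min (r ^ 2 / 8) (w / 2) * R := by
    push_cast at hsmall
    rw [← hRdef] at hsmall
    linarith
  have hn := chA_norm
  have hcc := chA_cont
  have G := good_line W hW hW0 a u hu M hM r w hr hw hwl
  obtain ⟨s1, hs1, g1⟩ := G chA chA_mp hcc hn 1 chA_deriv_snd R hR hsm
  obtain ⟨s2, hs2, g2⟩ := G (fun p => chA (-p.1, p.2)) (chA_mp.comp neg_fst_mp) (by fun_prop)
    (fun p => by rw [hn]; ring) 1 (fun s t => chA_deriv_snd (-s) t) R hR hsm
  obtain ⟨t1, ht1, g3⟩ := G (fun p => chA (p.2, p.1)) (chA_mp.comp swap_mp) (by fun_prop)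
    (fun p => by rw [hn]; ring) 0 (fun s t => chA_deriv_fst s t) R hR hsm
  obtain ⟨t2, ht2, g4⟩ := G (fun p => chA (p.2, -p.1)) ((chA_mp.comp swap_mp).comp neg_fst_mp)
    (by fun_prop) (fun p => by rw [hn]; ring) 0 (fun s t => chA_deriv_fst (-s) t) R hR hsm
  set K : Set (EE 2) := {z | (-s2 ≤ z 0 ∧ z 0 ≤ s1) ∧ (-t2 ≤ z 1 ∧ z 1 ≤ t1)} with hK
  have hc0 : Continuous fun z : EE 2 => z 0 := by fun_prop
  have hc1 : Continuous fun z : EE 2 => z 1 := by fun_prop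
  have hKclosed : IsClosed K :=
    ((isClosed_le continuous_const hc0).inter (isClosed_le hc0 continuous_const)).inter
      ((isClosed_le continuous_const hc1).inter (isClosed_le hc1 continuous_const))
  have hns : ∀ z : EE 2, ‖z‖ ^ 2 = z 0 ^ 2 + z 1 ^ 2 := fun z => by
    have := chA_norm (z 0, z 1)
    rwa [chA_self] at this
  have hKc : IsCompact K := by
    refine (isCompact_closedBall (0 : EE 2) (4 * R)).of_isClosed_subset hKclosed ?_
    rintro z ⟨⟨b1, b2⟩, b3, b4⟩
    rw [mem_closedBall_zero_iff]
    refine le_of_sq_le_sq ?_ (by positivity)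
    rw [hns]
    nlinarith [hs1.2, hs2.2, ht1.2, ht2.2]
  have hopen : IsOpen {z : EE 2 | (-s2 < z 0 ∧ z 0 < s1) ∧ (-t2 < z 1 ∧ z 1 < t1)} :=
    ((isOpen_lt continuous_const hc0).inter (isOpen_lt hc0 continuous_const)).inter
      ((isOpen_lt continuous_const hc1).inter (isOpen_lt hc1 continuous_const))
  refine replacement W hW a hWa hWpos hW0 r₀ r hr hrr hmono u hu hmin K hKc ?_ x ?_
  · intro z hz
    obtain ⟨⟨b1, b2⟩, b3, b4⟩ := hKclosed.frontier_subset hz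
    have hz0 : z 0 ∈ Set.Icc (-(2 * R)) (2 * R) :=
      ⟨by linarith [hs2.2], by linarith [hs1.2]⟩
    have hz1 : z 1 ∈ Set.Icc (-(2 * R)) (2 * R) :=
      ⟨by linarith [ht2.2], by linarith [ht1.2]⟩
    have hself := chA_self z
    rcases eq_or_lt_of_le b1 with e | l1
    · have := g2 _ hz1
      simp only [e, hself] at this
      exact this
    rcases eq_or_lt_of_le b2 with e | l2
    · have := g1 _ hz1
      rwa [← e, hself] at this
    rcases eq_or_lt_of_le b3 with e | l3
    · have := g4 _ hz0
      simp only [e, hself] at this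
      exact this
    rcases eq_or_lt_of_le b4 with e | l4
    · have := g3 _ hz0
      simp only [← e, hself] at this
      exact this
    exfalso
    refine hz.2 ?_
    refine mem_interior.2 ⟨_, ?_, hopen, ⟨⟨l1, l2⟩, l3, l4⟩⟩
    rintro y ⟨⟨c1, c2⟩, c3, c4⟩
    exact ⟨⟨c1.le, c2.le⟩, c3.le, c4.le⟩
  · have hx2 := hns x
    have a0 : |x 0| ≤ R := by
      refine le_trans ?_ hN3
      exact abs_le_of_sq_le_sq (by nlinarith [sq_nonneg (x 1)]) (norm_nonneg _)
    have a1 : |x 1| ≤ R := by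
      refine le_trans ?_ hN3
      exact abs_le_of_sq_le_sq (by nlinarith [sq_nonneg (x 0)]) (norm_nonneg _)
    rw [abs_le] at a0 a1
    exact ⟨⟨by linarith [hs2.1], by linarith [hs1.1]⟩, by linarith [ht2.1], by linarith [ht1.1]⟩

/-- Theorem 1.3, Case (b), second part: for `n = 2` and `W ∈ C^{1,1}_loc`, if
`r ↦ W(a + rν)` is nondecreasing on `(0, r₀]` for every unit vector `ν`, then any
bounded globally minimizing solution is identically `a`. -/
theorem liouville_two_dim_mono
    (m : ℕ) (hm : 1 ≤ m)
    (W : EuclideanSpace ℝ (Fin m) → ℝ)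
    (hW : ContDiff ℝ 1 W) (hW' : LocallyLipschitz (fun v => gradient W v))
    (a : EuclideanSpace ℝ (Fin m))
    (hWa : W a = 0) (hWpos : ∀ v, v ≠ a → 0 < W v)
    (r₀ : ℝ) (hr₀ : 0 < r₀)
    (hmono : ∀ ν : EuclideanSpace ℝ (Fin m), ‖ν‖ = 1 →
      MonotoneOn (fun r : ℝ => W (a + r • ν)) (Set.Ioc 0 r₀))
    (u : EuclideanSpace ℝ (Fin 2) → EuclideanSpace ℝ (Fin m))
    (hu : ContDiff ℝ 2 u)
    (hbdd : ∃ C, ∀ x, ‖u x‖ ≤ C)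
    (hsol : ∀ x, vlap u x = gradient W (u x))
    (hmin : GloballyMinimizing W u) :
    ∀ x, u x = a := by
  obtain ⟨C, hC⟩ := hbdd
  have hW0 : ∀ v, 0 ≤ W v := fun y => by
    by_cases h : y = a
    · rw [h, hWa]
    · exact (hWpos y h).le
  intro x
  have key : ∀ r, 0 < r → 2 * r ≤ r₀ → ‖u x - a‖ ≤ 2 * r := fun r h1 h2 =>
    final_step W hW.continuous a hWa hWpos hW0 r₀ r h1 h2 hmono u hu hmin (C + ‖a‖)
      (fun z => (norm_sub_le _ _).trans (by linarith [hC z])) x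
  by_contra hne
  have hp : 0 < ‖u x - a‖ := norm_pos_iff.2 (sub_ne_zero.2 hne)
  have hm0 : 0 < min (‖u x - a‖ / 4) (r₀ / 2) := lt_min (by positivity) (by positivity)
  have h1 := key (min (‖u x - a‖ / 4) (r₀ / 2)) hm0
    (by linarith [min_le_right (‖u x - a‖ / 4) (r₀ / 2)])
  linarith [min_le_left (‖u x - a‖ / 4) (r₀ / 2)]
end

section
/- Let W ∈ C¹(ℝᵐ;ℝ) be nonnegative and let u ∈ C²(ℝⁿ;ℝᵐ), n ≥ 2, m ≥ 1, solve Δu = ∇W(u) on ℝⁿ. Then the function R ↦ (1/R^{n-2}) · ∫_{B_R} ( ((n-2)/2)|∇u|² + n·W(u) ) dx is nondecreasing on (0,∞), i.e. its derivative with respect to R is ≥ 0 for all R > 0. -/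
open MeasureTheory Metric Filter RealInnerProductSpace

/-- The energy density. -/
noncomputable def edens {n m : ℕ} (W : EuclideanSpace ℝ (Fin m) → ℝ)
    (u : EuclideanSpace ℝ (Fin n) → EuclideanSpace ℝ (Fin m))
    (x : EuclideanSpace ℝ (Fin n)) : ℝ := (1 / 2) * gradSq u x + W (u x)

/-- The stress tensor applied to the position vector. -/
noncomputable def stressX {n m : ℕ} (W : EuclideanSpace ℝ (Fin m) → ℝ)
    (u : EuclideanSpace ℝ (Fin n) → EuclideanSpace ℝ (Fin m)) (i : Fin n)
    (x : EuclideanSpace ℝ (Fin n)) : ℝ :=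
  inner ℝ (fderiv ℝ u x (EuclideanSpace.single i 1)) (fderiv ℝ u x x) - x i * edens W u x

/-- The integrand of the monotonicity formula. -/
noncomputable def fdens {n m : ℕ} (W : EuclideanSpace ℝ (Fin m) → ℝ)
    (u : EuclideanSpace ℝ (Fin n) → EuclideanSpace ℝ (Fin m))
    (x : EuclideanSpace ℝ (Fin n)) : ℝ :=
  ((n : ℝ) - 2) / 2 * gradSq u x + (n : ℝ) * W (u x)

section aux

variable {n m : ℕ} {W : EuclideanSpace ℝ (Fin m) → ℝ}
  {u : EuclideanSpace ℝ (Fin n) → EuclideanSpace ℝ (Fin m)}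

theorem contDiff_fd (hu : ContDiff ℝ 2 u) : ContDiff ℝ 1 (fderiv ℝ u) :=
  hu.fderiv_right (by norm_num)

theorem contDiff_gradSq (hu : ContDiff ℝ 2 u) : ContDiff ℝ 1 (gradSq u) := by
  unfold gradSq
  have := contDiff_fd hu
  refine ContDiff.sum fun i _ => ?_
  exact (this.clm_apply contDiff_const).norm_sq ℝ

theorem contDiff_edens (hW : ContDiff ℝ 1 W) (hu : ContDiff ℝ 2 u) :
    ContDiff ℝ 1 (edens W u) := by
  unfold edens
  exact (contDiff_const.mul (contDiff_gradSq hu)).add (hW.comp (hu.of_le (by norm_num)))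

theorem contDiff_fdens (hW : ContDiff ℝ 1 W) (hu : ContDiff ℝ 2 u) :
    ContDiff ℝ 1 (fdens W u) := by
  unfold fdens
  exact (contDiff_const.mul (contDiff_gradSq hu)).add
    (contDiff_const.mul (hW.comp (hu.of_le (by norm_num))))

theorem contDiff_coord (i : Fin n) :
    ContDiff ℝ 1 (fun x : EuclideanSpace ℝ (Fin n) => x i) :=
  (EuclideanSpace.proj (𝕜 := ℝ) i).contDiff

theorem contDiff_stressX (hW : ContDiff ℝ 1 W) (hu : ContDiff ℝ 2 u) (i : Fin n) :
    ContDiff ℝ 1 (stressX W u i) := by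
  unfold stressX
  have := contDiff_fd hu
  exact ((this.clm_apply contDiff_const).inner ℝ (this.clm_apply contDiff_id)).sub
    ((contDiff_coord i).mul (contDiff_edens hW hu))

theorem sum_single (x : EuclideanSpace ℝ (Fin n)) :
    ∑ i, x i • EuclideanSpace.single i (1 : ℝ) = x := by
  ext j
  simp [Pi.single_apply]

theorem sum_coord_apply (L : EuclideanSpace ℝ (Fin n) →L[ℝ] ℝ) (x : EuclideanSpace ℝ (Fin n)) :
    ∑ i, x i * L (EuclideanSpace.single i (1 : ℝ)) = L x := by
  conv_rhs => rw [← sum_single x]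
  simp

theorem sum_coord_apply' (L : EuclideanSpace ℝ (Fin n) →L[ℝ] EuclideanSpace ℝ (Fin m))
    (x : EuclideanSpace ℝ (Fin n)) :
    ∑ i, x i • L (EuclideanSpace.single i (1 : ℝ)) = L x := by
  conv_rhs => rw [← sum_single x]
  simp

/-- The derivative of the energy density. -/
theorem fderiv_edens (hW : ContDiff ℝ 1 W) (hu : ContDiff ℝ 2 u)
    (x v : EuclideanSpace ℝ (Fin n)) :
    fderiv ℝ (edens W u) x v =
      (∑ i, inner ℝ (fderiv ℝ u x (EuclideanSpace.single i 1))
        (fderiv ℝ (fderiv ℝ u) x v (EuclideanSpace.single i 1)))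
      + inner ℝ (gradient W (u x)) (fderiv ℝ u x v) := by
  have h2 : HasFDerivAt (fderiv ℝ u) (fderiv ℝ (fderiv ℝ u) x) x :=
    ((contDiff_fd hu).differentiable (by norm_num) x).hasFDerivAt
  have h1 : HasFDerivAt u (fderiv ℝ u x) x :=
    (hu.differentiable (by norm_num) x).hasFDerivAt
  have hWd : HasFDerivAt W (fderiv ℝ W (u x)) (u x) :=
    (hW.differentiable (by norm_num) (u x)).hasFDerivAt
  have hg : HasFDerivAt (gradSq u) _ x :=
    HasFDerivAt.fun_sum (u := Finset.univ) fun i _ =>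
      (h2.clm_apply (hasFDerivAt_const (EuclideanSpace.single i (1:ℝ)) x)).norm_sq
  have he : HasFDerivAt (edens W u) _ x := (hg.const_mul (1/2)).add (hWd.comp x h1)
  rw [he.fderiv]
  have : inner ℝ (gradient W (u x)) (fderiv ℝ u x v) = fderiv ℝ W (u x) (fderiv ℝ u x v) := by
    simp [gradient]
  rw [this]
  simp [Finset.mul_sum]

theorem div_stressX (hW : ContDiff ℝ 1 W) (hu : ContDiff ℝ 2 u)
    (hsol : ∀ x, vlap u x = gradient W (u x)) (x : EuclideanSpace ℝ (Fin n)) :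
    ∑ i, fderiv ℝ (stressX W u i) x (EuclideanSpace.single i 1) = - fdens W u x := by
  have h2 : HasFDerivAt (fderiv ℝ u) (fderiv ℝ (fderiv ℝ u) x) x :=
    ((contDiff_fd hu).differentiable (by norm_num) x).hasFDerivAt
  have he : HasFDerivAt (edens W u) (fderiv ℝ (edens W u) x) x :=
    ((contDiff_edens hW hu).differentiable (by norm_num) x).hasFDerivAt
  have hsymm : ∀ v w, fderiv ℝ (fderiv ℝ u) x v w = fderiv ℝ (fderiv ℝ u) x w v := by
    have := (hu.contDiffAt (x := x)).isSymmSndFDerivAt (by simp)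
    exact fun v w => this v w
  have key : ∀ i, fderiv ℝ (stressX W u i) x (EuclideanSpace.single i 1) =
      inner ℝ (fderiv ℝ (fderiv ℝ u) x (EuclideanSpace.single i 1) (EuclideanSpace.single i 1))
        (fderiv ℝ u x x)
      + inner ℝ (fderiv ℝ u x (EuclideanSpace.single i 1))
        (fderiv ℝ (fderiv ℝ u) x x (EuclideanSpace.single i 1))
      + ‖fderiv ℝ u x (EuclideanSpace.single i 1)‖ ^ 2
      - edens W u x - x i * fderiv ℝ (edens W u) x (EuclideanSpace.single i 1) := by
    intro i
    have hs : HasFDerivAt (stressX W u i) _ x :=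
      ((h2.clm_apply (hasFDerivAt_const (EuclideanSpace.single i (1:ℝ)) x)).inner ℝ
        (h2.clm_apply (hasFDerivAt_id x))).sub
      (((EuclideanSpace.proj (𝕜 := ℝ) i).hasFDerivAt (x := x)).mul he)
    rw [hs.fderiv, hsymm x]
    simp [inner_add_right, fderivInnerCLM_apply]
    ring
  have hl : ∑ i, fderiv ℝ (fderiv ℝ u) x (EuclideanSpace.single i 1) (EuclideanSpace.single i 1)
      = gradient W (u x) := by
    rw [← hsol x]
    unfold vlap
    refine Finset.sum_congr rfl fun i _ => ?_
    rw [(h2.clm_apply (hasFDerivAt_const (EuclideanSpace.single i (1:ℝ)) x)).fderiv]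
    simp
  simp_rw [key]
  rw [Finset.sum_sub_distrib, Finset.sum_sub_distrib, Finset.sum_add_distrib,
    Finset.sum_add_distrib, ← sum_inner, hl, sum_coord_apply, fderiv_edens hW hu]
  have : ∑ i, ‖fderiv ℝ u x (EuclideanSpace.single i 1)‖ ^ 2 = gradSq u x := rfl
  rw [this]
  simp [fdens, edens]
  ring

theorem integral_fderiv_zero {g : EuclideanSpace ℝ (Fin n) → ℝ} (hg : ContDiff ℝ 1 g)
    (hc : HasCompactSupport g) (v : EuclideanSpace ℝ (Fin n)) :
    ∫ x, fderiv ℝ g x v = 0 := by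
  have hi : Integrable (fun x => fderiv ℝ g x v) :=
    ((hg.continuous_fderiv (by norm_num)).clm_apply continuous_const).integrable_of_hasCompactSupport
      (hc.fderiv_apply ℝ v)
  have := integral_mul_fderiv_eq_neg_fderiv_mul_of_integrable (μ := volume) (𝕜 := ℝ)
    (f := fun _ : EuclideanSpace ℝ (Fin n) => (1:ℝ)) (g := g) (v := v)
    (by simp) (by simpa using hi)
    (by simpa using hg.continuous.integrable_of_hasCompactSupport hc)
    (fun x _ => by fun_prop) (fun x _ => hg.differentiable (by norm_num) x)
  simpa using this

theorem pohozaev (hW : ContDiff ℝ 1 W) (hu : ContDiff ℝ 2 u)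
    (hsol : ∀ x, vlap u x = gradient W (u x)) {φ : EuclideanSpace ℝ (Fin n) → ℝ}
    (hφ : ContDiff ℝ 1 φ) (hc : HasCompactSupport φ) :
    ∫ x, φ x * fdens W u x =
      ∫ x, ∑ i, fderiv ℝ φ x (EuclideanSpace.single i 1) * stressX W u i x := by
  have hX := contDiff_stressX (n := n) hW hu
  have h0 : ∀ i, ∫ x, fderiv ℝ (fun y => φ y * stressX W u i y) x
      (EuclideanSpace.single i 1) = 0 := fun i =>
    integral_fderiv_zero (hφ.mul (hX i)) hc.mul_right _
  have hI : ∀ i, Integrable (fun x => fderiv ℝ (fun y => φ y * stressX W u i y) x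
      (EuclideanSpace.single i (1:ℝ))) := fun i =>
    (((hφ.mul (hX i)).continuous_fderiv (by norm_num)).clm_apply
      continuous_const).integrable_of_hasCompactSupport (hc.mul_right.fderiv_apply ℝ _)
  have hI1 : Integrable (fun x => ∑ i, fderiv ℝ φ x (EuclideanSpace.single i 1) *
      stressX W u i x) := by
    refine integrable_finsetSum _ fun i _ => ?_
    exact (((hφ.continuous_fderiv (by norm_num)).clm_apply continuous_const).mul
      (hX i).continuous).integrable_of_hasCompactSupport ((hc.fderiv_apply ℝ _).mul_right)
  have hI2 : Integrable (fun x => φ x * fdens W u x) :=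
    (hφ.continuous.mul (contDiff_fdens hW hu).continuous).integrable_of_hasCompactSupport
      hc.mul_right
  have h1 : ∫ x, ∑ i, fderiv ℝ (fun y => φ y * stressX W u i y) x
      (EuclideanSpace.single i (1:ℝ)) = 0 := by
    rw [integral_finsetSum _ fun i _ => hI i]
    simp [h0]
  have h3 : ∀ x, ∑ i, fderiv ℝ (fun y => φ y * stressX W u i y) x
      (EuclideanSpace.single i (1:ℝ)) =
      (∑ i, fderiv ℝ φ x (EuclideanSpace.single i 1) * stressX W u i x)
        - φ x * fdens W u x := by
    intro x
    have : ∀ i, fderiv ℝ (fun y => φ y * stressX W u i y) x (EuclideanSpace.single i (1:ℝ)) =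
      fderiv ℝ φ x (EuclideanSpace.single i 1) * stressX W u i x +
        φ x * fderiv ℝ (stressX W u i) x (EuclideanSpace.single i 1) := by
      intro i
      rw [fderiv_fun_mul (hφ.differentiable (by norm_num) x)
        ((hX i).differentiable (by norm_num) x)]
      simp
      ring
    simp_rw [this]
    rw [Finset.sum_add_distrib, ← Finset.mul_sum, div_stressX hW hu hsol]
    ring
  simp_rw [h3] at h1
  rw [integral_sub hI1 hI2] at h1
  linarith

theorem compactSupport_cut {η : ℝ → ℝ} (h0 : ∀ t, 1 ≤ t → η t = 0) {R : ℝ} (hR : 0 < R) :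
    HasCompactSupport (fun x : EuclideanSpace ℝ (Fin n) => η (‖x‖ ^ 2 / R ^ 2)) := by
  refine HasCompactSupport.intro (isCompact_closedBall 0 R) fun x hx => h0 _ ?_
  rw [one_le_div (by positivity)]
  simp at hx
  gcongr

theorem contDiff_cut {η : ℝ → ℝ} (hη : ContDiff ℝ 1 η) (R : ℝ) :
    ContDiff ℝ 1 (fun x : EuclideanSpace ℝ (Fin n) => η (‖x‖ ^ 2 / R ^ 2)) :=
  hη.comp ((contDiff_norm_sq ℝ).div_const _)

theorem deriv_zero_cut {η : ℝ → ℝ} (hη : ContDiff ℝ 1 η) (h0 : ∀ t, 1 ≤ t → η t = 0) :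
    ∀ t, 1 ≤ t → deriv η t = 0 := by
  intro t ht
  have hd : HasDerivWithinAt η (deriv η t) (Set.Ici t) t :=
    (hη.differentiable (by norm_num) t).hasDerivAt.hasDerivWithinAt
  have h1 : HasDerivWithinAt η 0 (Set.Ici t) t :=
    (hasDerivWithinAt_const t (Set.Ici t) (0:ℝ)).congr (fun y hy => h0 y (ht.trans hy)) (h0 t ht)
  exact (uniqueDiffWithinAt_Ici t).eq_deriv _ hd h1

theorem hasDerivAt_cutint {η : ℝ → ℝ} (hη : ContDiff ℝ 1 η) (h0 : ∀ t, 1 ≤ t → η t = 0)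
    {f : EuclideanSpace ℝ (Fin n) → ℝ} (hf : Continuous f) {R : ℝ} (hR : 0 < R) :
    HasDerivAt (fun R : ℝ => ∫ x, η (‖x‖ ^ 2 / R ^ 2) * f x)
      (∫ x, deriv η (‖x‖ ^ 2 / R ^ 2) * (-2 * ‖x‖ ^ 2 / R ^ 3) * f x) R := by
  have hη' : Continuous (deriv η) := hη.continuous_deriv (by norm_num)
  have hd0 := deriv_zero_cut hη h0
  -- bounds
  obtain ⟨M, hM⟩ := (isCompact_Icc (a := (0:ℝ)) (b := 1)).exists_bound_of_continuousOn
    hη'.continuousOn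
  obtain ⟨C, hC⟩ := (isCompact_closedBall (0 : EuclideanSpace ℝ (Fin n)) (2 * R)
    ).exists_bound_of_continuousOn hf.continuousOn
  have hM0 : 0 ≤ M := (norm_nonneg _).trans (hM 0 (by simp))
  have hC0 : 0 ≤ C := (norm_nonneg _).trans (hC 0 (by simp; positivity))
  refine (hasDerivAt_integral_of_dominated_loc_of_deriv_le (μ := volume)
    (F := fun (R : ℝ) (x : EuclideanSpace ℝ (Fin n)) => η (‖x‖ ^ 2 / R ^ 2) * f x)
    (F' := fun (R : ℝ) (x : EuclideanSpace ℝ (Fin n)) =>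
      deriv η (‖x‖ ^ 2 / R ^ 2) * (-2 * ‖x‖ ^ 2 / R ^ 3) * f x)
    (s := Set.Ioo (R / 2) (2 * R))
    (bound := (closedBall (0 : EuclideanSpace ℝ (Fin n)) (2 * R)).indicator
      (fun _ => M * (2 * (2 * R) ^ 2 / (R / 2) ^ 3) * C))
    (Ioo_mem_nhds (by linarith) (by linarith)) ?_ ?_ ?_ ?_ ?_ ?_).2
  · refine Filter.Eventually.of_forall fun r => Continuous.aestronglyMeasurable ?_
    exact (contDiff_cut hη r).continuous.mul hf
  · exact ((contDiff_cut hη R).continuous.mul hf).integrable_of_hasCompactSupport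
      (compactSupport_cut h0 hR).mul_right
  · refine Continuous.aestronglyMeasurable ?_
    fun_prop
  · refine Filter.Eventually.of_forall fun x r hr => ?_
    have hr0 : 0 < r := by have := hr.1; linarith
    by_cases hx : ‖x‖ ^ 2 / r ^ 2 ≤ 1
    · have hxr : ‖x‖ ≤ r := by
        rw [div_le_one (by positivity)] at hx
        exact le_of_sq_le_sq hx hr0.le
      have hxR : ‖x‖ ≤ 2 * R := hxr.trans hr.2.le
      have hmem : x ∈ closedBall (0 : EuclideanSpace ℝ (Fin n)) (2 * R) := by simpa using hxR
      rw [Set.indicator_of_mem hmem, norm_mul, norm_mul]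
      have e1 := hM _ ⟨by positivity, hx⟩
      have e2 := hC x hmem
      have e3 : ‖-2 * ‖x‖ ^ 2 / r ^ 3‖ ≤ 2 * (2 * R) ^ 2 / (R / 2) ^ 3 := by
        rw [norm_div, norm_mul, norm_neg, norm_pow, norm_pow, norm_norm, Real.norm_ofNat,
          Real.norm_of_nonneg hr0.le]
        have := hr.1
        gcongr
      gcongr
    · rw [hd0 _ (not_le.1 hx).le]
      simp only [zero_mul, norm_zero]
      exact Set.indicator_nonneg (fun _ _ => by positivity) _
  · exact (integrable_indicator_iff measurableSet_closedBall).2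
      (integrableOn_const (isCompact_closedBall _ _).measure_ne_top)
  · refine Filter.Eventually.of_forall fun x r hr => ?_
    have hr0 : 0 < r := by have := hr.1; linarith
    refine HasDerivAt.mul_const ?_ _
    have h1 : HasDerivAt (fun r : ℝ => ‖x‖ ^ 2 / r ^ 2) (-2 * ‖x‖ ^ 2 / r ^ 3) r := by
      have := (hasDerivAt_const r (‖x‖ ^ 2)).fun_div (hasDerivAt_pow 2 r) (by positivity)
      refine this.congr_deriv ?_
      push_cast
      field_simp
      ring
    exact ((hη.differentiable (by norm_num) _).hasDerivAt).comp r h1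

theorem monotone_cut (hn : 2 ≤ n) (hW : ContDiff ℝ 1 W) (hWnonneg : ∀ v, 0 ≤ W v)
    (hu : ContDiff ℝ 2 u) (hsol : ∀ x, vlap u x = gradient W (u x))
    {η : ℝ → ℝ} (hη : ContDiff ℝ 1 η) (h0 : ∀ t, 1 ≤ t → η t = 0) (hanti : Antitone η) :
    MonotoneOn (fun R : ℝ => (1 / R ^ (n - 2)) * ∫ x, η (‖x‖ ^ 2 / R ^ 2) * fdens W u x)
      (Set.Ioi 0) := by
  have hf := (contDiff_fdens (n := n) hW hu).continuous
  have hη' : Continuous (deriv η) := hη.continuous_deriv (by norm_num)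
  have hd0 := deriv_zero_cut hη h0
  obtain ⟨k, rfl⟩ : ∃ k, n = k + 2 := ⟨n - 2, by omega⟩
  simp only [Nat.add_sub_cancel]
  have hD : ∀ R : ℝ, 0 < R → HasDerivAt
      (fun R : ℝ => (1 / R ^ k) * ∫ x, η (‖x‖ ^ 2 / R ^ 2) * fdens W u x)
      (((0 * R ^ k - 1 * (k * R ^ (k - 1))) / (R ^ k) ^ 2) *
        (∫ x, η (‖x‖ ^ 2 / R ^ 2) * fdens W u x) + (1 / R ^ k) *
        ∫ x, deriv η (‖x‖ ^ 2 / R ^ 2) * (-2 * ‖x‖ ^ 2 / R ^ 3) * fdens W u x) R := by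
    intro R hR
    exact ((hasDerivAt_const R (1:ℝ)).div (hasDerivAt_pow k R) (by positivity)).mul
      (hasDerivAt_cutint hη h0 hf hR)
  refine monotoneOn_of_deriv_nonneg (convex_Ioi 0)
    (fun R hR => (hD R hR).continuousAt.continuousWithinAt) ?_ ?_
  · rw [interior_Ioi]
    exact fun R hR => (hD R hR).differentiableAt.differentiableWithinAt
  rw [interior_Ioi]
  intro R hR
  have hR : 0 < R := hR
  rw [(hD R hR).deriv]
  -- Pohozaev
  have hP := pohozaev hW hu hsol (contDiff_cut hη R) (compactSupport_cut h0 hR)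
  have hfd : ∀ (x v : EuclideanSpace ℝ (Fin (k + 2))),
      fderiv ℝ (fun x : EuclideanSpace ℝ (Fin (k + 2)) => η (‖x‖ ^ 2 / R ^ 2)) x v =
        deriv η (‖x‖ ^ 2 / R ^ 2) * (2 / R ^ 2 * inner ℝ x v) := by
    intro x v
    have h1 : HasFDerivAt (fun x : EuclideanSpace ℝ (Fin (k + 2)) => ‖x‖ ^ 2 / R ^ 2) _ x :=
      ((hasFDerivAt_id x).norm_sq).mul_const (R ^ 2)⁻¹
    have h2 : HasFDerivAt (fun x : EuclideanSpace ℝ (Fin (k + 2)) => η (‖x‖ ^ 2 / R ^ 2)) _ x :=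
      ((hη.differentiable (by norm_num) (‖x‖ ^ 2 / R ^ 2)).hasDerivAt).comp_hasFDerivAt
      x h1
    rw [h2.fderiv]
    simp
    left
    ring
  have hsum : ∀ x : EuclideanSpace ℝ (Fin (k + 2)),
      ∑ i, fderiv ℝ (fun x : EuclideanSpace ℝ (Fin (k + 2)) => η (‖x‖ ^ 2 / R ^ 2)) x
        (EuclideanSpace.single i 1) * stressX W u i x =
      deriv η (‖x‖ ^ 2 / R ^ 2) * (2 / R ^ 2 *
        (‖fderiv ℝ u x x‖ ^ 2 - ‖x‖ ^ 2 * edens W u x)) := by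
    intro x
    have e1 : ∑ i, x i * stressX W u i x = ‖fderiv ℝ u x x‖ ^ 2 - ‖x‖ ^ 2 * edens W u x := by
      unfold stressX
      simp_rw [mul_sub, Finset.sum_sub_distrib, ← mul_assoc, ← Finset.sum_mul]
      congr 1
      · rw [← real_inner_self_eq_norm_sq]
        nth_rewrite 2 [← sum_coord_apply']
        rw [sum_inner]
        simp [real_inner_smul_left]
      · rw [EuclideanSpace.real_norm_sq_eq]
        simp [sq]
    rw [← e1, Finset.mul_sum, Finset.mul_sum]
    refine Finset.sum_congr rfl fun i _ => ?_
    have hi : inner ℝ x (EuclideanSpace.single i (1:ℝ)) = x i := by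
      simp [EuclideanSpace.inner_single_right]
    rw [hfd, hi]
    ring
  simp_rw [hsum] at hP
  have hcs := compactSupport_cut (n := k + 2) hd0 hR
  have hcd : Continuous fun x : EuclideanSpace ℝ (Fin (k + 2)) =>
      deriv η (‖x‖ ^ 2 / R ^ 2) := by fun_prop
  have hce := (contDiff_edens (n := k + 2) hW hu).continuous
  have hcf := (contDiff_fd (n := k + 2) hu).continuous
  have hJ1 : Integrable (fun x : EuclideanSpace ℝ (Fin (k + 2)) =>
      deriv η (‖x‖ ^ 2 / R ^ 2) * (2 / R ^ 2 *
        (‖fderiv ℝ u x x‖ ^ 2 - ‖x‖ ^ 2 * edens W u x))) :=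
    Continuous.integrable_of_hasCompactSupport
      (hcd.mul (continuous_const.mul ((((hcf.clm_apply continuous_id).norm).pow 2).sub
        ((continuous_norm.pow 2).mul hce)))) hcs.mul_right
  have hJ2 : Integrable (fun x : EuclideanSpace ℝ (Fin (k + 2)) =>
      deriv η (‖x‖ ^ 2 / R ^ 2) * (-2 * ‖x‖ ^ 2 / R ^ 3) * fdens W u x) :=
    Continuous.integrable_of_hasCompactSupport (by fun_prop) hcs.mul_right.mul_right
  have hkey : 0 ≤ R * (∫ x, deriv η (‖x‖ ^ 2 / R ^ 2) * (-2 * ‖x‖ ^ 2 / R ^ 3) * fdens W u x)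
      - k * ∫ x, η (‖x‖ ^ 2 / R ^ 2) * fdens W u x := by
    rw [hP, ← integral_const_mul, ← integral_const_mul,
      ← integral_sub (hJ2.const_mul R) (hJ1.const_mul (k:ℝ))]
    refine integral_nonneg fun x => ?_
    have e : R * (deriv η (‖x‖ ^ 2 / R ^ 2) * (-2 * ‖x‖ ^ 2 / R ^ 3) * fdens W u x) -
        k * (deriv η (‖x‖ ^ 2 / R ^ 2) * (2 / R ^ 2 *
        (‖fderiv ℝ u x x‖ ^ 2 - ‖x‖ ^ 2 * edens W u x))) =
        (- deriv η (‖x‖ ^ 2 / R ^ 2)) * (2 / R ^ 2 *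
          (2 * ‖x‖ ^ 2 * W (u x) + k * ‖fderiv ℝ u x x‖ ^ 2)) := by
      unfold fdens edens
      push_cast
      field_simp
      ring
    show 0 ≤ R * (deriv η (‖x‖ ^ 2 / R ^ 2) * (-2 * ‖x‖ ^ 2 / R ^ 3) * fdens W u x) -
        k * (deriv η (‖x‖ ^ 2 / R ^ 2) * (2 / R ^ 2 *
        (‖fderiv ℝ u x x‖ ^ 2 - ‖x‖ ^ 2 * edens W u x)))
    rw [e]
    have := hWnonneg (u x)
    have hd : deriv η (‖x‖ ^ 2 / R ^ 2) ≤ 0 := hanti.deriv_nonpos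
    have : 0 ≤ - deriv η (‖x‖ ^ 2 / R ^ 2) := by linarith
    positivity
  generalize (∫ x, deriv η (‖x‖ ^ 2 / R ^ 2) * (-2 * ‖x‖ ^ 2 / R ^ 3) * fdens W u x) = J at *
  generalize (∫ x, η (‖x‖ ^ 2 / R ^ 2) * fdens W u x) = I at *
  have : (0 * R ^ k - 1 * (k * R ^ (k - 1))) / (R ^ k) ^ 2 * I + 1 / R ^ k * J =
      (R * J - k * I) / R ^ (k + 1) := by
    rcases k with _ | k
    · simp
      field_simp
    · simp only [Nat.add_sub_cancel]
      field_simp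
      ring
  rw [this]
  positivity

end aux


/-- Theorem A.1, weak monotonicity formula: for any solution of `Δu = ∇W(u)` with
`W ∈ C¹` nonnegative, the function
`R ↦ R^{2-n} ∫_{B_R} ( ((n-2)/2)|∇u|² + n W(u) ) dx` is nondecreasing on `(0,∞)`. -/
theorem weak_monotonicity_formula
    (n m : ℕ) (hn : 2 ≤ n) (hm : 1 ≤ m)
    (W : EuclideanSpace ℝ (Fin m) → ℝ) (hW : ContDiff ℝ 1 W)
    (hWnonneg : ∀ v, 0 ≤ W v)
    (u : EuclideanSpace ℝ (Fin n) → EuclideanSpace ℝ (Fin m))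
    (hu : ContDiff ℝ 2 u)
    (hsol : ∀ x, vlap u x = gradient W (u x)) :
    MonotoneOn
      (fun R : ℝ => (1 / R ^ (n - 2)) *
        ∫ x in ball (0 : EuclideanSpace ℝ (Fin n)) R,
          (((n : ℝ) - 2) / 2 * gradSq u x + (n : ℝ) * W (u x)))
      (Set.Ioi 0) := by
  have hf := (contDiff_fdens (n := n) hW hu).continuous
  set η : ℕ → ℝ → ℝ := fun j t => Real.smoothTransition (j * (1 - t)) with hηdef
  have hη : ∀ j, ContDiff ℝ 1 (η j) := fun j =>
    (Real.smoothTransition.contDiff (n := 1)).comp (by fun_prop)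
  have h0 : ∀ j t, 1 ≤ t → η j t = 0 := fun j t ht =>
    Real.smoothTransition.zero_of_nonpos
      (mul_nonpos_of_nonneg_of_nonpos (by positivity) (by linarith))
  have hanti : ∀ j, Antitone (η j) := fun j s t hst =>
    Real.smoothTransition.monotone (by gcongr)
  have hmono := fun j => monotone_cut hn hW hWnonneg hu hsol (hη j) (h0 j) (hanti j)
  have hlim : ∀ R : ℝ, 0 < R → Tendsto
      (fun j => (1 / R ^ (n - 2)) * ∫ x, η j (‖x‖ ^ 2 / R ^ 2) * fdens W u x) atTop
      (nhds ((1 / R ^ (n - 2)) *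
        ∫ x in ball (0 : EuclideanSpace ℝ (Fin n)) R,
          (((n : ℝ) - 2) / 2 * gradSq u x + (n : ℝ) * W (u x)))) := by
    intro R hR
    refine Tendsto.const_mul _ ?_
    rw [← integral_indicator measurableSet_ball]
    refine tendsto_integral_of_dominated_convergence
      ((closedBall (0 : EuclideanSpace ℝ (Fin n)) R).indicator (fun x => ‖fdens W u x‖))
      (fun j => ((contDiff_cut (hη j) R).continuous.mul hf).aestronglyMeasurable) ?_ ?_ ?_
    · exact (integrable_indicator_iff measurableSet_closedBall).2
        (hf.norm.continuousOn.integrableOn_compact (isCompact_closedBall _ _))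
    · refine fun j => Filter.Eventually.of_forall fun x => ?_
      by_cases hx : x ∈ closedBall (0 : EuclideanSpace ℝ (Fin n)) R
      · rw [Set.indicator_of_mem hx, norm_mul]
        have : ‖η j (‖x‖ ^ 2 / R ^ 2)‖ ≤ 1 := by
          rw [Real.norm_of_nonneg (Real.smoothTransition.nonneg _)]
          exact Real.smoothTransition.le_one _
        exact mul_le_of_le_one_left (norm_nonneg _) this
      · rw [Set.indicator_of_notMem hx, h0]
        · simp
        · rw [one_le_div (by positivity)]
          simp at hx
          gcongr
    · refine Filter.Eventually.of_forall fun x => ?_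
      by_cases hx : x ∈ ball (0 : EuclideanSpace ℝ (Fin n)) R
      · rw [Set.indicator_of_mem hx]
        have hlt : ‖x‖ ^ 2 / R ^ 2 < 1 := by
          rw [div_lt_one (by positivity)]
          simp at hx
          gcongr
        obtain ⟨N, hN⟩ := exists_nat_ge (1 / (1 - ‖x‖ ^ 2 / R ^ 2))
        refine tendsto_const_nhds.congr' ?_
        filter_upwards [eventually_ge_atTop N] with j hj
        have : η j (‖x‖ ^ 2 / R ^ 2) = 1 := by
          refine Real.smoothTransition.one_of_one_le ?_
          rw [div_le_iff₀ (by linarith)] at hN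
          refine hN.trans ?_
          have : (N:ℝ) ≤ j := by exact_mod_cast hj
          have : 0 ≤ 1 - ‖x‖ ^ 2 / R ^ 2 := by linarith
          gcongr
        rw [this, one_mul]
        rfl
      · rw [Set.indicator_of_notMem hx]
        refine tendsto_const_nhds.congr fun j => ?_
        rw [h0, zero_mul]
        rw [one_le_div (by positivity)]
        simp at hx
        gcongr
  intro r hr R hR hrR
  exact le_of_tendsto_of_tendsto' (hlim r hr) (hlim R hR) fun j => hmono j hr hR hrR
end
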